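/- arXiv:1901.07224 — 2 statements merged into one kernel-verified Lean document; each statement's English description precedes it below -/
import Mathlib

section
/- Maximum principle for graphical translators: let c ∈ ℝ, let Ω ⊂ ℝ² be a bounded, open, connected set, and let E ⊂ ∂Ω be a finite set. Suppose u₁, u₂ are c-translator solutions on Ω such that liminf_{x→q} (u₂(x) − u₁(x)) ≥ 0 for every q ∈ ∂Ω \ E. Then u₂ ≥ u₁ on Ω; moreover, if u₂(p) = u₁(p) for some p ∈ Ω, then u₁ = u₂ on all of Ω. -/
open Real Set Filter Topology

/-- The partial derivative in the first (x) direction. -/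
noncomputable def pdx (u : ℝ × ℝ → ℝ) (p : ℝ × ℝ) : ℝ := fderiv ℝ u p (1, 0)

/-- The partial derivative in the second (t) direction. -/
noncomputable def pdt (u : ℝ × ℝ → ℝ) (p : ℝ × ℝ) : ℝ := fderiv ℝ u p (0, 1)

/-- `u` is a c-translator solution on `Ω`: it is C² on `Ω` and satisfies
`(1+u_t²)u_xx - 2u_x u_t u_xt + (1+u_x²)u_tt + c u_t (1+u_x²+u_t²) = 0` there. -/
def IsTranslator (c : ℝ) (Ω : Set (ℝ × ℝ)) (u : ℝ × ℝ → ℝ) : Prop :=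
  ContDiffOn ℝ 2 u Ω ∧ ∀ p ∈ Ω,
    (1 + pdt u p ^ 2) * pdx (pdx u) p - 2 * pdx u p * pdt u p * pdx (pdt u) p
      + (1 + pdx u p ^ 2) * pdt (pdt u) p
      + c * pdt u p * (1 + pdx u p ^ 2 + pdt u p ^ 2) = 0

/-! ### Calculus of the two partial derivatives -/

lemma fderiv_pair_apply (u : ℝ × ℝ → ℝ) (p : ℝ × ℝ) (a b : ℝ) :
    fderiv ℝ u p (a, b) = a * pdx u p + b * pdt u p := by
  have h : ((a, b) : ℝ × ℝ) = a • (1, 0) + b • (0, 1) := by simp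
  rw [h, map_add, map_smul, map_smul]
  simp [pdx, pdt]

lemma ContDiffAt.pdx {u : ℝ × ℝ → ℝ} {p : ℝ × ℝ} (hu : ContDiffAt ℝ 2 u p) :
    ContDiffAt ℝ 1 (pdx u) p :=
  (hu.fderiv_right (m := 1) (by norm_num)).clm_apply contDiffAt_const

lemma ContDiffAt.pdt {u : ℝ × ℝ → ℝ} {p : ℝ × ℝ} (hu : ContDiffAt ℝ 2 u p) :
    ContDiffAt ℝ 1 (pdt u) p :=
  (hu.fderiv_right (m := 1) (by norm_num)).clm_apply contDiffAt_const

lemma ContDiffAt.continuousAt_fderiv_apply {u : ℝ × ℝ → ℝ} {p : ℝ × ℝ}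
    (hu : ContDiffAt ℝ 1 u p) (v : ℝ × ℝ) : ContinuousAt (fun q => fderiv ℝ u q v) p :=
  ((hu.fderiv_right (m := 0) (by norm_num)).clm_apply contDiffAt_const).continuousAt

lemma fderiv_fderiv_apply {u : ℝ × ℝ → ℝ} {p : ℝ × ℝ} (hu : ContDiffAt ℝ 2 u p)
    (v w : ℝ × ℝ) :
    fderiv ℝ (fun q => fderiv ℝ u q v) p w = fderiv ℝ (fderiv ℝ u) p w v := by
  have hd : DifferentiableAt ℝ (fderiv ℝ u) p :=
    (hu.fderiv_right (m := 1) (by norm_num)).differentiableAt (by norm_num)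
  rw [fderiv_clm_apply hd (differentiableAt_const v)]
  simp

lemma pdt_pdx_eq {u : ℝ × ℝ → ℝ} {p : ℝ × ℝ} (hu : ContDiffAt ℝ 2 u p) :
    pdt (pdx u) p = pdx (pdt u) p := by
  change fderiv ℝ (fun q => fderiv ℝ u q (1, 0)) p (0, 1)
    = fderiv ℝ (fun q => fderiv ℝ u q (0, 1)) p (1, 0)
  rw [fderiv_fderiv_apply hu, fderiv_fderiv_apply hu]
  exact (hu.isSymmSndFDerivAt (by simp)) _ _

lemma fderiv_sub_apply' {u v : ℝ × ℝ → ℝ} {p : ℝ × ℝ} (hu : DifferentiableAt ℝ u p)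
    (hv : DifferentiableAt ℝ v p) (a : ℝ × ℝ) :
    fderiv ℝ (fun x => u x - v x) p a = fderiv ℝ u p a - fderiv ℝ v p a := by
  rw [fderiv_fun_sub hu hv]; rfl

lemma fderiv_fderiv_sub_apply {u v : ℝ × ℝ → ℝ} {p : ℝ × ℝ} (hu : ContDiffAt ℝ 2 u p)
    (hv : ContDiffAt ℝ 2 v p) (a b : ℝ × ℝ) :
    fderiv ℝ (fun q => fderiv ℝ (fun x => u x - v x) q b) p a
      = fderiv ℝ (fun q => fderiv ℝ u q b) p a - fderiv ℝ (fun q => fderiv ℝ v q b) p a := by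
  have he : (fun q => fderiv ℝ (fun x => u x - v x) q b)
      =ᶠ[𝓝 p] fun q => fderiv ℝ u q b - fderiv ℝ v q b := by
    filter_upwards [hu.eventually (by simp), hv.eventually (by simp)] with q h1 h2
    exact fderiv_sub_apply' (h1.differentiableAt (by norm_num))
      (h2.differentiableAt (by norm_num)) b
  rw [he.fderiv_eq]
  refine fderiv_sub_apply' ?_ ?_ a
  · exact ((hu.fderiv_right (m := 1) (by norm_num)).clm_apply
      contDiffAt_const).differentiableAt (by norm_num)
  · exact ((hv.fderiv_right (m := 1) (by norm_num)).clm_apply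
      contDiffAt_const).differentiableAt (by norm_num)

lemma hasDerivAt_pdx {u : ℝ × ℝ → ℝ} {p : ℝ × ℝ} (hu : DifferentiableAt ℝ u p) :
    HasDerivAt (fun s => u (s, p.2)) (pdx u p) p.1 :=
  HasFDerivAt.comp_hasDerivAt (f := fun s : ℝ => (s, p.2)) p.1 hu.hasFDerivAt
    ((hasDerivAt_id p.1).prodMk (hasDerivAt_const p.1 p.2))

lemma hasDerivAt_pdt {u : ℝ × ℝ → ℝ} {p : ℝ × ℝ} (hu : DifferentiableAt ℝ u p) :
    HasDerivAt (fun s => u (p.1, s)) (pdt u p) p.2 :=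
  HasFDerivAt.comp_hasDerivAt (f := fun s : ℝ => (p.1, s)) p.2 hu.hasFDerivAt
    ((hasDerivAt_const p.2 p.1).prodMk (hasDerivAt_id p.2))

/-! ### Second order condition at a local minimum -/

lemma deriv_deriv_nonneg_of_isLocalMin {φ : ℝ → ℝ} {s : ℝ} (hφ : ContinuousAt φ s)
    (hmin : IsLocalMin φ s) : 0 ≤ deriv (deriv φ) s := by
  by_contra! hneg
  have hmax := isLocalMax_of_deriv_deriv_neg hneg hmin.deriv_eq_zero hφ
  have hc : φ =ᶠ[𝓝 s] fun _ => φ s := by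
    filter_upwards [hmin, hmax] with x h1 h2 using le_antisymm h2 h1
  have h0 : deriv (deriv φ) s = 0 := by
    rw [hc.deriv.deriv_eq]; simp
  exact hneg.ne h0

lemma IsLocalMin.hessian_nonneg {f : ℝ × ℝ → ℝ} {m : ℝ × ℝ} (hf : ContDiffAt ℝ 2 f m)
    (hmin : IsLocalMin f m) (a b : ℝ) :
    0 ≤ a ^ 2 * pdx (pdx f) m + 2 * a * b * pdx (pdt f) m + b ^ 2 * pdt (pdt f) m := by
  have hl : ∀ s : ℝ, HasDerivAt (fun s : ℝ => m + s • ((a, b) : ℝ × ℝ)) (a, b) s := by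
    intro s
    simpa using ((hasDerivAt_id s).smul_const ((a, b) : ℝ × ℝ)).const_add m
  have hl0 : m + (0 : ℝ) • ((a, b) : ℝ × ℝ) = m := by simp
  have hcont : Tendsto (fun s : ℝ => m + s • ((a, b) : ℝ × ℝ)) (𝓝 0) (𝓝 m) := by
    simpa using (hl 0).continuousAt.tendsto
  set φ : ℝ → ℝ := fun s => f (m + s • ((a, b) : ℝ × ℝ)) with hφ
  have hmin' : IsLocalMin φ 0 := by
    filter_upwards [hcont.eventually hmin] with s hs
    simpa only [hφ, hl0] using hs
  have hφc : ContinuousAt φ 0 := by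
    refine ContinuousAt.comp (g := f) ?_ (hl 0).continuousAt
    rw [hl0]; exact hf.continuousAt
  have hd : deriv φ =ᶠ[𝓝 0] fun s => a * pdx f (m + s • ((a, b) : ℝ × ℝ))
      + b * pdt f (m + s • ((a, b) : ℝ × ℝ)) := by
    filter_upwards [hcont.eventually (hf.eventually (by simp))] with s hs
    rw [← fderiv_pair_apply]
    exact (HasFDerivAt.comp_hasDerivAt s
      (hs.differentiableAt (by norm_num)).hasFDerivAt (hl s)).deriv
  have key : ∀ g : ℝ × ℝ → ℝ, ContDiffAt ℝ 1 g m →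
      HasDerivAt (fun s : ℝ => g (m + s • ((a, b) : ℝ × ℝ)))
        (a * pdx g m + b * pdt g m) 0 := by
    intro g hg
    have h1 : HasFDerivAt g (fderiv ℝ g m) (m + (0 : ℝ) • ((a, b) : ℝ × ℝ)) := by
      rw [hl0]; exact (hg.differentiableAt (by norm_num)).hasFDerivAt
    rw [← fderiv_pair_apply]
    exact HasFDerivAt.comp_hasDerivAt (0 : ℝ) h1 (hl 0)
  have h2 := ((key _ hf.pdx).const_mul a).fun_add ((key _ hf.pdt).const_mul b)
  have h3 := deriv_deriv_nonneg_of_isLocalMin hφc hmin'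
  rw [hd.deriv_eq, h2.deriv, pdt_pdx_eq hf] at h3
  linarith

/-! ### The strong minimum principle -/

/-- The square of the Euclidean distance on `ℝ × ℝ`. -/
def distSq (p y : ℝ × ℝ) : ℝ := (p.1 - y.1) ^ 2 + (p.2 - y.2) ^ 2

lemma continuous_distSq (y : ℝ × ℝ) : Continuous fun p => distSq p y := by
  unfold distSq; fun_prop

lemma hasDerivAt_neg_mul_distSq_fst (y : ℝ × ℝ) (α : ℝ) (p : ℝ × ℝ) :
    HasDerivAt (fun s : ℝ => -(α * distSq (s, p.2) y)) (-(α * (2 * (p.1 - y.1)))) p.1 := by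
  unfold distSq
  simpa using (((((hasDerivAt_id p.1).sub_const y.1).fun_pow 2).add_const
    ((p.2 - y.2) ^ 2)).const_mul α).fun_neg

lemma hasDerivAt_neg_mul_distSq_snd (y : ℝ × ℝ) (α : ℝ) (p : ℝ × ℝ) :
    HasDerivAt (fun s : ℝ => -(α * distSq (p.1, s) y)) (-(α * (2 * (p.2 - y.2)))) p.2 := by
  unfold distSq
  simpa using (((((hasDerivAt_id p.2).sub_const y.2).fun_pow 2).const_add
    ((p.1 - y.1) ^ 2)).const_mul α).fun_neg

/-- The Hopf barrier `ε (exp (-α |p - y|²) - k)`. -/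
noncomputable def hopfBarrier (y : ℝ × ℝ) (α ε k : ℝ) (p : ℝ × ℝ) : ℝ :=
  ε * (exp (-(α * distSq p y)) - k)

lemma contDiff_hopfBarrier (y : ℝ × ℝ) (α ε k : ℝ) {n : ℕ∞} :
    ContDiff ℝ n (hopfBarrier y α ε k) := by
  unfold hopfBarrier distSq; fun_prop

lemma pdx_hopfBarrier (y : ℝ × ℝ) (α ε k : ℝ) :
    pdx (hopfBarrier y α ε k)
      = fun p => -(2 * α * ε) * (p.1 - y.1) * exp (-(α * distSq p y)) := by
  funext p
  have h := hasDerivAt_pdx (u := hopfBarrier y α ε k) (p := p)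
    ((contDiff_hopfBarrier y α ε k (n := 1)).differentiable (by norm_num) p)
  refine h.unique ?_
  have h2 := hasDerivAt_neg_mul_distSq_fst y α p
  refine ((h2.exp.sub_const k).const_mul ε).congr_deriv ?_
  unfold distSq; ring

lemma pdt_hopfBarrier (y : ℝ × ℝ) (α ε k : ℝ) :
    pdt (hopfBarrier y α ε k)
      = fun p => -(2 * α * ε) * (p.2 - y.2) * exp (-(α * distSq p y)) := by
  funext p
  have h := hasDerivAt_pdt (u := hopfBarrier y α ε k) (p := p)
    ((contDiff_hopfBarrier y α ε k (n := 1)).differentiable (by norm_num) p)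
  refine h.unique ?_
  have h2 := hasDerivAt_neg_mul_distSq_snd y α p
  refine ((h2.exp.sub_const k).const_mul ε).congr_deriv ?_
  unfold distSq; ring

lemma pdx_pdx_hopfBarrier (y : ℝ × ℝ) (α ε k : ℝ) (p : ℝ × ℝ) :
    pdx (pdx (hopfBarrier y α ε k)) p
      = ε * (4 * α ^ 2 * (p.1 - y.1) ^ 2 - 2 * α) * exp (-(α * distSq p y)) := by
  have hd := (contDiff_hopfBarrier y α ε k (n := 2)).contDiffAt (x := p) |>.pdx
  have h := hasDerivAt_pdx (hd.differentiableAt (by norm_num))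
  refine h.unique ?_
  rw [pdx_hopfBarrier]
  have h2 := hasDerivAt_neg_mul_distSq_fst y α p
  refine ((((hasDerivAt_id p.1).sub_const y.1).const_mul (-(2 * α * ε))).mul
    h2.exp).congr_deriv ?_
  unfold distSq; simp; ring

lemma pdt_pdt_hopfBarrier (y : ℝ × ℝ) (α ε k : ℝ) (p : ℝ × ℝ) :
    pdt (pdt (hopfBarrier y α ε k)) p
      = ε * (4 * α ^ 2 * (p.2 - y.2) ^ 2 - 2 * α) * exp (-(α * distSq p y)) := by
  have hd := (contDiff_hopfBarrier y α ε k (n := 2)).contDiffAt (x := p) |>.pdt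
  have h := hasDerivAt_pdt (hd.differentiableAt (by norm_num))
  refine h.unique ?_
  rw [pdt_hopfBarrier]
  have h2 := hasDerivAt_neg_mul_distSq_snd y α p
  refine ((((hasDerivAt_id p.2).sub_const y.2).const_mul (-(2 * α * ε))).mul
    h2.exp).congr_deriv ?_
  unfold distSq; simp; ring

lemma pdx_pdt_hopfBarrier (y : ℝ × ℝ) (α ε k : ℝ) (p : ℝ × ℝ) :
    pdx (pdt (hopfBarrier y α ε k)) p
      = ε * (4 * α ^ 2 * (p.1 - y.1) * (p.2 - y.2)) * exp (-(α * distSq p y)) := by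
  have hd := (contDiff_hopfBarrier y α ε k (n := 2)).contDiffAt (x := p) |>.pdt
  have h := hasDerivAt_pdx (hd.differentiableAt (by norm_num))
  refine h.unique ?_
  rw [pdt_hopfBarrier]
  have h2 := hasDerivAt_neg_mul_distSq_fst y α p
  refine (h2.exp.const_mul (-(2 * α * ε) * (p.2 - y.2))).congr_deriv ?_
  unfold distSq; ring

set_option maxHeartbeats 1000000 in
/-- A positive supersolution of a linear elliptic equation cannot touch zero at a boundary point
of a ball on which it is otherwise positive. -/
lemma false_of_touching_ball {Ω : Set (ℝ × ℝ)} (hΩ : IsOpen Ω) {w n₁ n₂ b₁ b₂ : ℝ × ℝ → ℝ}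
    (hw : ∀ p ∈ Ω, ContDiffAt ℝ 2 w p)
    (hn₁ : ContinuousOn n₁ Ω) (hn₂ : ContinuousOn n₂ Ω)
    (hb₁ : ContinuousOn b₁ Ω) (hb₂ : ContinuousOn b₂ Ω)
    (heq : ∀ p ∈ Ω, pdx (pdx w) p + pdt (pdt w) p
      + (n₁ p ^ 2 * pdx (pdx w) p + 2 * n₁ p * n₂ p * pdx (pdt w) p + n₂ p ^ 2 * pdt (pdt w) p)
      + b₁ p * pdx w p + b₂ p * pdt w p = 0)
    (hnonneg : ∀ p ∈ Ω, 0 ≤ w p) {z y : ℝ × ℝ} (hz : z ∈ Ω) (hwz : w z = 0) (hzy : z ≠ y)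
    (hpos : ∀ p ∈ Ω, distSq p y ≤ distSq z y → p ≠ z → 0 < w p) : False := by
  have hr : 0 < distSq z y := by
    unfold distSq
    rcases ne_or_eq z.1 y.1 with h | h
    · have := sq_pos_of_ne_zero (sub_ne_zero.2 h); positivity
    · have h' : z.2 ≠ y.2 := fun h' => hzy (Prod.ext h h')
      have := sq_pos_of_ne_zero (sub_ne_zero.2 h'); positivity
  obtain ⟨δ, hδ, hball⟩ : ∃ δ > 0, Metric.closedBall z δ ⊆
      Ω ∩ {p | distSq z y / 2 < distSq p y} := by
    refine Metric.nhds_basis_closedBall.mem_iff.1 (inter_mem (hΩ.mem_nhds hz) ?_)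
    exact (isOpen_lt continuous_const (continuous_distSq y)).mem_nhds
      (by simp only [mem_ofPred_eq]; linarith)
  have hBΩ : Metric.closedBall z δ ⊆ Ω := fun p hp => (hball hp).1
  have hBc : IsCompact (Metric.closedBall z δ) := isCompact_closedBall z δ
  obtain ⟨K, hK⟩ : ∃ K, ∀ p ∈ Metric.closedBall z δ,
      2 * (2 + n₁ p ^ 2 + n₂ p ^ 2) + 2 * (b₁ p * (p.1 - y.1) + b₂ p * (p.2 - y.2)) ≤ K := by
    have hc : ContinuousOn (fun p : ℝ × ℝ => 2 * (2 + n₁ p ^ 2 + n₂ p ^ 2)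
        + 2 * (b₁ p * (p.1 - y.1) + b₂ p * (p.2 - y.2))) (Metric.closedBall z δ) := by
      have := hn₁.mono hBΩ
      have := hn₂.mono hBΩ
      have := hb₁.mono hBΩ
      have := hb₂.mono hBΩ
      fun_prop
    obtain ⟨K, hK⟩ := (hBc.image_of_continuousOn hc).bddAbove
    exact ⟨K, fun p hp => hK ⟨p, hp, rfl⟩⟩
  obtain ⟨α, hα, hαK⟩ : ∃ α : ℝ, 0 < α ∧ K < 4 * α * (distSq z y / 2) := by
    refine ⟨|K| / distSq z y + 1, by positivity, ?_⟩
    have : 4 * (|K| / distSq z y + 1) * (distSq z y / 2) = 2 * |K| + 2 * distSq z y := by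
      field_simp; ring
    rw [this]
    have := le_abs_self K
    have := abs_nonneg K
    linarith
  obtain ⟨ε, hε, hεw⟩ : ∃ ε : ℝ, 0 < ε ∧ ∀ p ∈ Metric.sphere z δ,
      distSq p y ≤ distSq z y → ε < w p := by
    have hScomp : IsCompact (Metric.sphere z δ ∩ {p | distSq p y ≤ distSq z y}) :=
      (isCompact_sphere z δ).inter_right (isClosed_le (continuous_distSq y) continuous_const)
    rcases (Metric.sphere z δ ∩ {p | distSq p y ≤ distSq z y}).eq_empty_or_nonempty with h | h
    · refine ⟨1, one_pos, fun p hp hq => ?_⟩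
      have : p ∈ Metric.sphere z δ ∩ {p | distSq p y ≤ distSq z y} := ⟨hp, hq⟩
      simp [h] at this
    · obtain ⟨m, hm, hmin⟩ := hScomp.exists_isMinOn h (f := w) (fun p hp =>
        (hw p (hBΩ (Metric.sphere_subset_closedBall hp.1))).continuousAt.continuousWithinAt)
      have hwm : 0 < w m := hpos m (hBΩ (Metric.sphere_subset_closedBall hm.1)) hm.2 (by
        rintro rfl; simpa [hδ.ne] using hm.1)
      refine ⟨w m / 2, by positivity, fun p hp hq => ?_⟩
      have := hmin (⟨hp, hq⟩ : p ∈ Metric.sphere z δ ∩ {p | distSq p y ≤ distSq z y})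
      simp only [mem_ofPred_eq] at this
      linarith
  set k := exp (-(α * distSq z y)) with hk
  set v := hopfBarrier y α ε k with hv
  have hv2 : ∀ p, ContDiffAt ℝ 2 v p := fun p => (contDiff_hopfBarrier y α ε k (n := 2)).contDiffAt
  obtain ⟨m, hm, hmin⟩ := hBc.exists_isMinOn (Metric.nonempty_closedBall.2 hδ.le)
    (f := fun p => w p - v p) (fun p hp =>
      ((hw p (hBΩ hp)).continuousAt.sub (hv2 p).continuousAt).continuousWithinAt)
  have hvz : v z = 0 := by simp [hv, hopfBarrier, hk]
  have hmle : w m - v m ≤ 0 := by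
    have := hmin (Metric.mem_closedBall_self hδ.le : z ∈ _)
    simpa [hwz, hvz] using this
  have hmball : m ∈ Metric.ball z δ := by
    rcases (Metric.mem_closedBall.1 hm).lt_or_eq with h | h
    · exact h
    exfalso
    rcases le_or_gt (distSq m y) (distSq z y) with hq | hq
    · have h1 := hεw m h hq
      have h2 : exp (-(α * distSq m y)) ≤ 1 := by
        rw [exp_le_one_iff]
        have : 0 ≤ distSq m y := by unfold distSq; positivity
        have := mul_nonneg hα.le this
        linarith
      have h3 : 0 < k := exp_pos _
      have h4 : v m ≤ ε := by
        simp only [hv, hopfBarrier]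
        nlinarith
      linarith
    · have h1 := hnonneg m (hBΩ hm)
      have h2 : exp (-(α * distSq m y)) < k := by
        rw [hk, exp_lt_exp]
        nlinarith
      have h4 : v m < 0 := by
        simp only [hv, hopfBarrier]
        exact mul_neg_of_pos_of_neg hε (by linarith)
      linarith
  have hmΩ := hBΩ hm
  have hloc : IsLocalMin (fun p => w p - v p) m := by
    filter_upwards [Metric.isOpen_ball.mem_nhds hmball] with p hp
    exact hmin (Metric.ball_subset_closedBall hp)
  have hf : ContDiffAt ℝ 2 (fun p => w p - v p) m := (hw m hmΩ).sub (hv2 m)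
  have hH := hloc.hessian_nonneg hf
  have hgrad : ∀ a, fderiv ℝ w m a = fderiv ℝ v m a := by
    intro a
    have h0 := hloc.fderiv_eq_zero
    have h1 := fderiv_sub_apply' ((hw m hmΩ).differentiableAt (by norm_num))
      ((hv2 m).differentiableAt (by norm_num)) a
    rw [h0] at h1
    simp only [zero_apply] at h1
    linarith
  have exx : pdx (pdx fun p => w p - v p) m = pdx (pdx w) m - pdx (pdx v) m :=
    fderiv_fderiv_sub_apply (hw m hmΩ) (hv2 m) _ _
  have ext : pdx (pdt fun p => w p - v p) m = pdx (pdt w) m - pdx (pdt v) m :=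
    fderiv_fderiv_sub_apply (hw m hmΩ) (hv2 m) _ _
  have ett : pdt (pdt fun p => w p - v p) m = pdt (pdt w) m - pdt (pdt v) m :=
    fderiv_fderiv_sub_apply (hw m hmΩ) (hv2 m) _ _
  rw [exx, ext, ett] at hH
  have e1 : pdx w m = pdx v m := hgrad _
  have e2 : pdt w m = pdt v m := hgrad _
  have hE := heq m hmΩ
  have H1 := hH 1 0
  have H2 := hH 0 1
  have H3 := hH (n₁ m) (n₂ m)
  rw [e1, e2] at hE
  have hx : pdx v m = -(2 * α * ε) * (m.1 - y.1) * exp (-(α * distSq m y)) := by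
    rw [hv, pdx_hopfBarrier]
  have ht : pdt v m = -(2 * α * ε) * (m.2 - y.2) * exp (-(α * distSq m y)) := by
    rw [hv, pdt_hopfBarrier]
  have hxx := pdx_pdx_hopfBarrier y α ε k m
  have hxt := pdx_pdt_hopfBarrier y α ε k m
  have htt := pdt_pdt_hopfBarrier y α ε k m
  rw [← hv] at hxx hxt htt
  have hsum : pdx (pdx v) m + pdt (pdt v) m
      + (n₁ m ^ 2 * pdx (pdx v) m + 2 * n₁ m * n₂ m * pdx (pdt v) m + n₂ m ^ 2 * pdt (pdt v) m)
      + b₁ m * pdx v m + b₂ m * pdt v m ≤ 0 := by linarith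
  rw [hx, ht, hxx, hxt, htt] at hsum
  have hfac : exp (-(α * distSq m y)) * (ε * α) * (4 * α * distSq m y
      + 4 * α * (n₁ m * (m.1 - y.1) + n₂ m * (m.2 - y.2)) ^ 2
      - (2 * (2 + n₁ m ^ 2 + n₂ m ^ 2) + 2 * (b₁ m * (m.1 - y.1) + b₂ m * (m.2 - y.2)))) ≤ 0 := by
    refine le_trans (le_of_eq ?_) hsum
    rw [distSq]; ring
  have hq : distSq z y / 2 < distSq m y := (hball hm).2
  have hKm := hK m hm
  have hsq : 0 ≤ 4 * α * (n₁ m * (m.1 - y.1) + n₂ m * (m.2 - y.2)) ^ 2 := by positivity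
  have h5 : 4 * α * (distSq z y / 2) ≤ 4 * α * distSq m y := by gcongr
  have h6 : 0 < exp (-(α * distSq m y)) * (ε * α) := by positivity
  have h7 : 0 < 4 * α * distSq m y
      + 4 * α * (n₁ m * (m.1 - y.1) + n₂ m * (m.2 - y.2)) ^ 2
      - (2 * (2 + n₁ m ^ 2 + n₂ m ^ 2) + 2 * (b₁ m * (m.1 - y.1) + b₂ m * (m.2 - y.2))) := by
    linarith
  exact absurd hfac (not_le.2 (mul_pos h6 h7))

/-- Strong minimum principle for linear elliptic equations in the plane whose principal part is
`Δ + (n · ∇)²`. -/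
lemma eq_zero_of_nonneg_of_elliptic {Ω : Set (ℝ × ℝ)} (hΩ : IsOpen Ω) (hΩc : IsPreconnected Ω)
    {w n₁ n₂ b₁ b₂ : ℝ × ℝ → ℝ} (hw : ∀ p ∈ Ω, ContDiffAt ℝ 2 w p)
    (hn₁ : ContinuousOn n₁ Ω) (hn₂ : ContinuousOn n₂ Ω)
    (hb₁ : ContinuousOn b₁ Ω) (hb₂ : ContinuousOn b₂ Ω)
    (heq : ∀ p ∈ Ω, pdx (pdx w) p + pdt (pdt w) p
      + (n₁ p ^ 2 * pdx (pdx w) p + 2 * n₁ p * n₂ p * pdx (pdt w) p + n₂ p ^ 2 * pdt (pdt w) p)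
      + b₁ p * pdx w p + b₂ p * pdt w p = 0)
    (hnonneg : ∀ p ∈ Ω, 0 ≤ w p) {p₀ : ℝ × ℝ} (hp₀ : p₀ ∈ Ω) (hwp₀ : w p₀ = 0) :
    ∀ p ∈ Ω, w p = 0 := by
  have hwc : ContinuousOn w Ω := fun p hp => (hw p hp).continuousAt.continuousWithinAt
  by_contra! hne
  obtain ⟨p₁, hp₁, hwp₁⟩ := hne
  have hUo : IsOpen (Ω ∩ w ⁻¹' Ioi 0) := hwc.isOpen_inter_preimage hΩ isOpen_Ioi
  have hsub : Ω ⊆ Ω ∩ w ⁻¹' Ioi 0 := by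
    refine hΩc.subset_of_closure_inter_subset hUo
      ⟨p₁, hp₁, hp₁, lt_of_le_of_ne (hnonneg _ hp₁) hwp₁.symm⟩ ?_
    rintro z₀ ⟨hz₀cl, hz₀⟩
    refine ⟨hz₀, lt_of_le_of_ne (hnonneg _ hz₀) fun hz₀0 => ?_⟩
    obtain ⟨r, hr, hball⟩ := Metric.nhds_basis_closedBall.mem_iff.1 (hΩ.mem_nhds hz₀)
    obtain ⟨y, ⟨hyΩ, hy0⟩, hyz⟩ := Metric.mem_closure_iff.1 hz₀cl (r / 4) (by positivity)
    have hcl : IsCompact (Metric.closedBall z₀ r ∩ {p | w p = 0}) := by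
      refine (isCompact_closedBall z₀ r).of_isClosed_subset ?_ inter_subset_left
      exact (hwc.mono hball).preimage_isClosed_of_isClosed Metric.isClosed_closedBall
        isClosed_singleton
    obtain ⟨z, ⟨hzb, hz0⟩, hzmin⟩ := hcl.exists_isMinOn
      ⟨z₀, Metric.mem_closedBall_self hr.le, hz₀0.symm⟩ (continuous_distSq y).continuousOn
    have hzy : z ≠ y := by rintro rfl; exact absurd hz0 (ne_of_gt hy0)
    have hdist : ∀ p : ℝ × ℝ, |p.1 - y.1| < r / 4 * 2 → |p.2 - y.2| < r / 4 * 2 →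
        p ∈ Metric.closedBall z₀ r := by
      intro p h1 h2
      rw [Prod.dist_eq, max_lt_iff, Real.dist_eq, Real.dist_eq] at hyz
      rw [Metric.mem_closedBall, Prod.dist_eq, max_le_iff, Real.dist_eq, Real.dist_eq]
      rw [abs_lt] at *
      rw [abs_lt] at hyz
      constructor <;> rw [abs_le] <;> constructor <;> linarith [hyz.1.1, hyz.1.2, hyz.2.1, hyz.2.2]
    have hzle : distSq z y ≤ distSq z₀ y :=
      isMinOn_iff.1 hzmin z₀ ⟨Metric.mem_closedBall_self hr.le, hz₀0.symm⟩
    have hz₀le : distSq z₀ y < 2 * (r / 4) ^ 2 := by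
      rw [Prod.dist_eq, max_lt_iff, Real.dist_eq, Real.dist_eq] at hyz
      have h1 := sq_lt_sq' (abs_lt.1 hyz.1).1 (abs_lt.1 hyz.1).2
      have h2 := sq_lt_sq' (abs_lt.1 hyz.2).1 (abs_lt.1 hyz.2).2
      unfold distSq; linarith
    have hin : ∀ p, distSq p y ≤ distSq z y → p ∈ Metric.closedBall z₀ r := by
      intro p hp
      have h : distSq p y < (r / 4 * 2) ^ 2 := by nlinarith
      unfold distSq at h
      refine hdist p (abs_lt_of_sq_lt_sq ?_ (by positivity))
        (abs_lt_of_sq_lt_sq ?_ (by positivity)) <;> nlinarith [sq_nonneg (p.1 - y.1),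
          sq_nonneg (p.2 - y.2)]
    set y' : ℝ × ℝ := ((y.1 + z.1) / 2, (y.2 + z.2) / 2) with hy'
    refine false_of_touching_ball hΩ hw hn₁ hn₂ hb₁ hb₂ heq hnonneg (z := z) (y := y')
      (hball hzb) hz0 ?_ ?_
    · intro h
      apply hzy
      have h1 := congrArg Prod.fst h
      have h2 := congrArg Prod.snd h
      simp only [hy'] at h1 h2
      exact Prod.ext (by linarith) (by linarith)
    · intro p hp hpd hpz
      have hlt : distSq p y < distSq z y := by
        have h3 : 0 < (p.1 - z.1) ^ 2 + (p.2 - z.2) ^ 2 := by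
          rcases ne_or_eq p.1 z.1 with h | h
          · have := sq_pos_of_ne_zero (sub_ne_zero.2 h); positivity
          · have h' : p.2 ≠ z.2 := fun h' => hpz (Prod.ext h h')
            have := sq_pos_of_ne_zero (sub_ne_zero.2 h'); positivity
        simp only [distSq, hy'] at hpd ⊢
        nlinarith
      refine lt_of_le_of_ne (hnonneg p hp) fun h0 => ?_
      have := isMinOn_iff.1 hzmin p ⟨hin p hlt.le, h0.symm⟩
      linarith
  exact absurd (hsub hp₀).2 (by simp [hwp₀])

/-! ### Cutoff functions with small gradient -/

open MeasureTheory

/-- The `ℓ¹` norm of the gradient. -/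
noncomputable def gradNorm (u : ℝ × ℝ → ℝ) (p : ℝ × ℝ) : ℝ := |pdx u p| + |pdt u p|

lemma ContDiff.continuous_gradNorm {u : ℝ × ℝ → ℝ} (hu : ContDiff ℝ 1 u) :
    Continuous (gradNorm u) := by
  have h := hu.continuous_fderiv (by norm_num)
  have h1 : Continuous (pdx u) := h.clm_apply continuous_const
  have h2 : Continuous (pdt u) := h.clm_apply continuous_const
  exact h1.abs.add h2.abs

lemma fderiv_mul_pair_apply {u v : ℝ × ℝ → ℝ} {p : ℝ × ℝ} (hu : DifferentiableAt ℝ u p)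
    (hv : DifferentiableAt ℝ v p) (a : ℝ × ℝ) :
    fderiv ℝ (fun x => u x * v x) p a = fderiv ℝ u p a * v p + u p * fderiv ℝ v p a := by
  rw [fderiv_fun_mul hu hv]
  simp
  ring

lemma gradNorm_mul_le {u v : ℝ × ℝ → ℝ} {p : ℝ × ℝ} (hu : DifferentiableAt ℝ u p)
    (hv : DifferentiableAt ℝ v p) (hu1 : |u p| ≤ 1) (hv1 : |v p| ≤ 1) :
    gradNorm (fun x => u x * v x) p ≤ gradNorm u p + gradNorm v p := by
  have key : ∀ a b c d : ℝ, |b| ≤ 1 → |c| ≤ 1 → |a * b + c * d| ≤ |a| + |d| := by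
    intro a b c d hb hc
    refine (abs_add_le _ _).trans (add_le_add ?_ ?_)
    · rw [abs_mul]; exact mul_le_of_le_one_right (abs_nonneg _) hb
    · rw [abs_mul]; exact mul_le_of_le_one_left (abs_nonneg _) hc
  have h1 : pdx (fun x => u x * v x) p = pdx u p * v p + u p * pdx v p :=
    fderiv_mul_pair_apply hu hv _
  have h2 : pdt (fun x => u x * v x) p = pdt u p * v p + u p * pdt v p :=
    fderiv_mul_pair_apply hu hv _
  unfold gradNorm
  rw [h1, h2]
  linarith [key (pdx u p) _ _ (pdx v p) hv1 hu1, key (pdt u p) _ _ (pdt v p) hv1 hu1]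

lemma exists_cutoff_singleton {e p₀ : ℝ × ℝ} (hne : p₀ ≠ e) {κ : ℝ} (hκ : 0 < κ) :
    ∃ χ : ℝ × ℝ → ℝ, ContDiff ℝ 1 χ ∧ (∀ x, 0 ≤ χ x ∧ χ x ≤ 1) ∧ (∀ᶠ x in 𝓝 e, χ x = 0) ∧
      (∀ x ∈ Metric.ball p₀ (dist p₀ e / 2), χ x = 1) ∧ Integrable (gradNorm χ) ∧
      ∫ x, gradNorm χ x ≤ κ := by
  let β : ContDiffBump (0 : ℝ × ℝ) := ⟨1, 2, one_pos, one_lt_two⟩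
  have hβ : ContDiff ℝ 1 β := β.contDiff
  have hd : 0 < dist p₀ e := dist_pos.2 hne
  set C := ∫ x, gradNorm β x with hC
  have hC0 : 0 ≤ C := integral_nonneg fun x => by unfold gradNorm; positivity
  set R := 4 / dist p₀ e + C / κ + 1 with hR
  have hRpos : 0 < R := by positivity
  have hgβ : Integrable (gradNorm β) := by
    refine hβ.continuous_gradNorm.integrable_of_hasCompactSupport ?_
    refine (β.hasCompactSupport.fderiv (𝕜 := ℝ)).mono fun x hx => ?_
    rw [Function.mem_support] at hx ⊢
    contrapose! hx
    simp [gradNorm, pdx, pdt, hx]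
  have hscale : ∀ x a, fderiv ℝ (fun x => 1 - β (R • (x - e))) x a
      = -(R * fderiv ℝ β (R • (x - e)) a) := by
    intro x a
    have h1 : HasFDerivAt (fun x : ℝ × ℝ => R • (x - e))
        (R • ContinuousLinearMap.id ℝ (ℝ × ℝ)) x :=
      ((hasFDerivAt_id x).sub_const e).const_smul R
    have h2 := ((hβ.differentiable (by norm_num) (R • (x - e))).hasFDerivAt.comp x h1).const_sub 1
    rw [HasFDerivAt.fderiv (f := fun x => 1 - β (R • (x - e))) h2]
    simp
  have hgrad : gradNorm (fun x => 1 - β (R • (x - e)))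
      = fun x => R * gradNorm β (R • (x - e)) := by
    funext x
    simp only [gradNorm, pdx, pdt, hscale, abs_neg, abs_mul, abs_of_pos hRpos]
    ring
  refine ⟨fun x => 1 - β (R • (x - e)), ?_, fun x => ?_, ?_, fun x hx => ?_, ?_, ?_⟩
  · exact contDiff_const.sub (hβ.comp (by fun_prop))
  · exact ⟨by linarith [β.le_one (x := R • (x - e))], by linarith [β.nonneg (x := R • (x - e))]⟩
  · have ht : Tendsto (fun x : ℝ × ℝ => R • (x - e)) (𝓝 e) (𝓝 0) := by
      have : Continuous fun x : ℝ × ℝ => R • (x - e) := by fun_prop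
      simpa using this.tendsto e
    filter_upwards [ht.eventually β.eventuallyEq_one] with x hx
    simp [hx]
  · change 1 - β (R • (x - e)) = 1
    rw [β.zero_of_le_dist, sub_zero]
    rw [dist_zero_right, norm_smul, Real.norm_of_nonneg hRpos.le, ← dist_eq_norm]
    have h1 := dist_triangle p₀ x e
    have h2 : dist p₀ x < dist p₀ e / 2 := by rw [dist_comm]; exact hx
    have h3 : 4 / dist p₀ e ≤ R := by
      have : 0 ≤ C / κ := by positivity
      linarith
    calc (2 : ℝ) = 4 / dist p₀ e * (dist p₀ e / 2) := by field_simp; norm_num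
      _ ≤ R * dist x e := by
        refine mul_le_mul h3 (by linarith) (by positivity) hRpos.le
  · rw [hgrad]
    exact ((hgβ.comp_smul hRpos.ne').comp_sub_right e).const_mul R
  · rw [hgrad, integral_const_mul, integral_sub_right_eq_self (fun x => gradNorm β (R • x)) e,
      Measure.integral_comp_smul]
    simp only [Module.finrank_prod, Module.finrank_self, smul_eq_mul]
    rw [abs_of_pos (by positivity), ← hC]
    have h3 : C / κ ≤ R := by
      have : 0 ≤ 4 / dist p₀ e := by positivity
      linarith
    rw [div_le_iff₀ hκ] at h3
    have : R * ((R ^ (1 + 1))⁻¹ * C) = C / R := by field_simp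
    rw [this, div_le_iff₀ hRpos]
    linarith

lemma exists_cutoff {E : Set (ℝ × ℝ)} (hE : E.Finite) {p₀ : ℝ × ℝ} (hp₀ : p₀ ∉ E) :
    ∃ r > 0, ∀ κ > 0, ∃ η : ℝ × ℝ → ℝ, ContDiff ℝ 1 η ∧ (∀ x, 0 ≤ η x ∧ η x ≤ 1) ∧
      (∀ e ∈ E, ∀ᶠ x in 𝓝 e, η x = 0) ∧ (∀ x ∈ Metric.ball p₀ r, η x = 1) ∧
      Integrable (gradNorm η) ∧ ∫ x, gradNorm η x ≤ κ := by
  induction E, hE using Set.Finite.induction_on with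
  | empty =>
    refine ⟨1, one_pos, fun κ hκ => ⟨fun _ => 1, contDiff_const, by simp, by simp, by simp, ?_⟩⟩
    have : gradNorm (fun _ : ℝ × ℝ => (1 : ℝ)) = fun _ => 0 := by
      funext x; simp [gradNorm, pdx, pdt]
    rw [this]
    simp [hκ.le]
  | @insert e E _ _ ih =>
    rw [mem_insert_iff, not_or] at hp₀
    obtain ⟨r, hr, h⟩ := ih hp₀.2
    refine ⟨min r (dist p₀ e / 2), lt_min hr (half_pos (dist_pos.2 hp₀.1)), fun κ hκ => ?_⟩
    obtain ⟨η, hη, hη01, hηE, hηb, hηi, hηκ⟩ := h (κ / 2) (half_pos hκ)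
    obtain ⟨χ, hχ, hχ01, hχe, hχb, hχi, hχκ⟩ := exists_cutoff_singleton hp₀.1 (half_pos hκ)
    have hle : ∀ x, gradNorm (fun x => η x * χ x) x ≤ gradNorm η x + gradNorm χ x := fun x =>
      gradNorm_mul_le (hη.differentiable (by norm_num) x) (hχ.differentiable (by norm_num) x)
        (abs_le.2 ⟨by linarith [hη01 x], (hη01 x).2⟩)
        (abs_le.2 ⟨by linarith [hχ01 x], (hχ01 x).2⟩)
    have hint : Integrable (gradNorm fun x => η x * χ x) := by
      refine (hηi.add hχi).mono' (hη.mul hχ).continuous_gradNorm.aestronglyMeasurable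
        (.of_forall fun x => ?_)
      rw [Real.norm_of_nonneg (by unfold gradNorm; positivity)]
      exact hle x
    refine ⟨fun x => η x * χ x, hη.mul hχ, fun x => ?_, ?_, fun x hx => ?_, hint, ?_⟩
    · exact ⟨mul_nonneg (hη01 x).1 (hχ01 x).1, mul_le_one₀ (hη01 x).2 (hχ01 x).1 (hχ01 x).2⟩
    · rintro q (rfl | hq)
      · filter_upwards [hχe] with x hx
        simp [hx]
      · filter_upwards [hηE q hq] with x hx
        simp [hx]
    · change η x * χ x = 1
      rw [hηb x (Metric.ball_subset_ball (min_le_left _ _) hx),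
        hχb x (Metric.ball_subset_ball (min_le_right _ _) hx), one_mul]
    · have := integral_mono hint (hηi.add hχi) hle
      rw [integral_add' hηi hχi] at this
      linarith

lemma integral_fderiv_eq_zero {F : ℝ × ℝ → ℝ} (hF : ContDiff ℝ 1 F) (hc : HasCompactSupport F)
    (v : ℝ × ℝ) : Integrable (fun x => fderiv ℝ F x v) ∧ ∫ x, fderiv ℝ F x v = 0 := by
  have hcont : Continuous fun x => fderiv ℝ F x v :=
    (hF.continuous_fderiv (by norm_num)).clm_apply continuous_const
  have hi : Integrable (fun x => fderiv ℝ F x v) :=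
    hcont.integrable_of_hasCompactSupport (hc.fderiv_apply (𝕜 := ℝ) v)
  refine ⟨hi, ?_⟩
  have h := integral_mul_fderiv_eq_neg_fderiv_mul_of_integrable (μ := volume)
    (f := fun _ : ℝ × ℝ => (1 : ℝ)) (g := F) (v := v) (by simp) (by simpa using hi)
    (by simpa using hF.continuous.integrable_of_hasCompactSupport hc)
    (fun x _ => differentiableAt_const _) (fun x _ => hF.differentiable (by norm_num) x)
  simpa using h

/-! ### The flux of a translator -/

/-- The quantity `√(1 + |∇u|²)`. -/
noncomputable def areaFactor (u : ℝ × ℝ → ℝ) (p : ℝ × ℝ) : ℝ := √(1 + pdx u p ^ 2 + pdt u p ^ 2)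

/-- The first component of `e^{ct} ∇u / √(1 + |∇u|²)`. -/
noncomputable def fluxX (c : ℝ) (u : ℝ × ℝ → ℝ) (p : ℝ × ℝ) : ℝ :=
  exp (c * p.2) * (pdx u p / areaFactor u p)

/-- The second component of `e^{ct} ∇u / √(1 + |∇u|²)`. -/
noncomputable def fluxT (c : ℝ) (u : ℝ × ℝ → ℝ) (p : ℝ × ℝ) : ℝ :=
  exp (c * p.2) * (pdt u p / areaFactor u p)

lemma areaFactor_pos (u : ℝ × ℝ → ℝ) (p : ℝ × ℝ) : 0 < areaFactor u p :=
  sqrt_pos.2 (by positivity)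

lemma areaFactor_sq (u : ℝ × ℝ → ℝ) (p : ℝ × ℝ) :
    areaFactor u p ^ 2 = 1 + pdx u p ^ 2 + pdt u p ^ 2 :=
  sq_sqrt (by positivity)

lemma ContDiffAt.areaFactor {u : ℝ × ℝ → ℝ} {p : ℝ × ℝ} (hu : ContDiffAt ℝ 2 u p) :
    ContDiffAt ℝ 1 (areaFactor u) p :=
  ((contDiffAt_const.add (hu.pdx.pow 2)).add (hu.pdt.pow 2)).sqrt (by positivity)

lemma ContDiffAt.fluxX {u : ℝ × ℝ → ℝ} {p : ℝ × ℝ} (c : ℝ) (hu : ContDiffAt ℝ 2 u p) :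
    ContDiffAt ℝ 1 (fluxX c u) p :=
  (contDiffAt_const.mul contDiffAt_snd).exp.mul
    (hu.pdx.div hu.areaFactor (areaFactor_pos u p).ne')

lemma ContDiffAt.fluxT {u : ℝ × ℝ → ℝ} {p : ℝ × ℝ} (c : ℝ) (hu : ContDiffAt ℝ 2 u p) :
    ContDiffAt ℝ 1 (fluxT c u) p :=
  (contDiffAt_const.mul contDiffAt_snd).exp.mul
    (hu.pdt.div hu.areaFactor (areaFactor_pos u p).ne')

lemma HasDerivAt.div_sqrt_one_add_sq {P T : ℝ → ℝ} {P' T' s : ℝ} (hP : HasDerivAt P P' s)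
    (hT : HasDerivAt T T' s) :
    HasDerivAt (fun r => P r / √(1 + P r ^ 2 + T r ^ 2))
      ((P' * (1 + T s ^ 2) - P s * T s * T') / √(1 + P s ^ 2 + T s ^ 2) ^ 3) s := by
  have hpos : 0 < 1 + P s ^ 2 + T s ^ 2 := by positivity
  have hS : HasDerivAt (fun r => 1 + P r ^ 2 + T r ^ 2) (2 * P s * P' + 2 * T s * T') s := by
    simpa using ((hP.fun_pow 2).const_add 1).fun_add (hT.fun_pow 2)
  have hW : 0 < √(1 + P s ^ 2 + T s ^ 2) := sqrt_pos.2 hpos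
  have hWsq : √(1 + P s ^ 2 + T s ^ 2) ^ 2 = 1 + P s ^ 2 + T s ^ 2 := sq_sqrt hpos.le
  refine (hP.fun_div (hS.sqrt hpos.ne') hW.ne').congr_deriv ?_
  generalize √(1 + P s ^ 2 + T s ^ 2) = W at *
  field_simp
  rw [hWsq]
  ring

lemma IsTranslator.contDiffAt {c : ℝ} {Ω : Set (ℝ × ℝ)} (hΩ : IsOpen Ω) {u : ℝ × ℝ → ℝ}
    (hu : IsTranslator c Ω u) {p : ℝ × ℝ} (hp : p ∈ Ω) : ContDiffAt ℝ 2 u p :=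
  hu.1.contDiffAt (hΩ.mem_nhds hp)

lemma IsTranslator.div_flux_eq_zero {c : ℝ} {Ω : Set (ℝ × ℝ)} (hΩ : IsOpen Ω) {u : ℝ × ℝ → ℝ}
    (hu : IsTranslator c Ω u) {p : ℝ × ℝ} (hp : p ∈ Ω) :
    pdx (fluxX c u) p + pdt (fluxT c u) p = 0 := by
  have hC := hu.contDiffAt hΩ hp
  have hxx := hasDerivAt_pdx (hC.pdx.differentiableAt (by norm_num))
  have htx := hasDerivAt_pdx (hC.pdt.differentiableAt (by norm_num))
  have hxt := hasDerivAt_pdt (hC.pdx.differentiableAt (by norm_num))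
  have htt := hasDerivAt_pdt (hC.pdt.differentiableAt (by norm_num))
  rw [pdt_pdx_eq hC] at hxt
  have e1 := (hasDerivAt_pdx ((hC.fluxX c).differentiableAt (by norm_num))).unique
    ((hxx.div_sqrt_one_add_sq htx).const_mul (exp (c * p.2)))
  have hexp : HasDerivAt (fun s : ℝ => exp (c * s)) (exp (c * p.2) * c) p.2 := by
    simpa using ((hasDerivAt_id p.2).const_mul c).exp
  have hdiv := htt.div_sqrt_one_add_sq hxt
  have e2 := (hasDerivAt_pdt ((hC.fluxT c).differentiableAt (by norm_num))).unique
    ((hexp.mul hdiv).congr_of_eventuallyEq (.of_forall fun s => by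
      simp only [fluxT, areaFactor, Pi.mul_apply]
      rw [add_right_comm]))
  rw [e1, e2]
  have hQ := hu.2 p hp
  have hperm : 1 + pdt u p ^ 2 + pdx u p ^ 2 = 1 + pdx u p ^ 2 + pdt u p ^ 2 := by ring
  rw [hperm]
  have hWsq := areaFactor_sq u p
  have hWpos := areaFactor_pos u p
  unfold areaFactor at hWsq hWpos
  generalize √(1 + pdx u p ^ 2 + pdt u p ^ 2) = W at *
  field_simp
  rw [hWsq]
  linear_combination exp (c * p.2) * hQ

lemma abs_fluxX_le (c : ℝ) (u : ℝ × ℝ → ℝ) (p : ℝ × ℝ) : |fluxX c u p| ≤ exp (c * p.2) := by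
  rw [fluxX, abs_mul, abs_of_pos (exp_pos _), abs_div, abs_of_pos (areaFactor_pos u p)]
  refine mul_le_of_le_one_right (exp_pos _).le ((div_le_one (areaFactor_pos u p)).2 ?_)
  exact abs_le_sqrt (by nlinarith [sq_nonneg (pdt u p)])

lemma abs_fluxT_le (c : ℝ) (u : ℝ × ℝ → ℝ) (p : ℝ × ℝ) : |fluxT c u p| ≤ exp (c * p.2) := by
  rw [fluxT, abs_mul, abs_of_pos (exp_pos _), abs_div, abs_of_pos (areaFactor_pos u p)]
  refine mul_le_of_le_one_right (exp_pos _).le ((div_le_one (areaFactor_pos u p)).2 ?_)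
  exact abs_le_sqrt (by nlinarith [sq_nonneg (pdx u p)])

/-- The flux difference of two functions paired with the difference of their gradients. -/
noncomputable def fluxPairing (c : ℝ) (u₁ u₂ : ℝ × ℝ → ℝ) (p : ℝ × ℝ) : ℝ :=
  (pdx u₁ p - pdx u₂ p) * (fluxX c u₁ p - fluxX c u₂ p)
    + (pdt u₁ p - pdt u₂ p) * (fluxT c u₁ p - fluxT c u₂ p)

lemma fluxPairing_eq (c : ℝ) (u₁ u₂ : ℝ × ℝ → ℝ) (p : ℝ × ℝ) :
    fluxPairing c u₁ u₂ p = exp (c * p.2) * ((areaFactor u₁ p + areaFactor u₂ p) / 2 *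
      ((pdx u₁ p / areaFactor u₁ p - pdx u₂ p / areaFactor u₂ p) ^ 2
        + (pdt u₁ p / areaFactor u₁ p - pdt u₂ p / areaFactor u₂ p) ^ 2
        + (1 / areaFactor u₁ p - 1 / areaFactor u₂ p) ^ 2)) := by
  have h1 := areaFactor_sq u₁ p
  have h2 := areaFactor_sq u₂ p
  have p1 := areaFactor_pos u₁ p
  have p2 := areaFactor_pos u₂ p
  unfold fluxPairing fluxX fluxT
  generalize areaFactor u₁ p = W at *
  generalize areaFactor u₂ p = V at *
  have h1' : pdx u₁ p ^ 2 = W ^ 2 - 1 - pdt u₁ p ^ 2 := by linarith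
  have h2' : pdx u₂ p ^ 2 = V ^ 2 - 1 - pdt u₂ p ^ 2 := by linarith
  field_simp
  ring_nf
  simp only [h1', h2']
  ring

lemma fluxPairing_nonneg (c : ℝ) (u₁ u₂ : ℝ × ℝ → ℝ) (p : ℝ × ℝ) :
    0 ≤ fluxPairing c u₁ u₂ p := by
  rw [fluxPairing_eq]
  have p1 := areaFactor_pos u₁ p
  have p2 := areaFactor_pos u₂ p
  positivity

lemma grad_eq_of_fluxPairing_le_zero {c : ℝ} {u₁ u₂ : ℝ × ℝ → ℝ} {p : ℝ × ℝ}
    (h : fluxPairing c u₁ u₂ p ≤ 0) : pdx u₁ p = pdx u₂ p ∧ pdt u₁ p = pdt u₂ p := by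
  rw [fluxPairing_eq] at h
  have p1 := areaFactor_pos u₁ p
  have p2 := areaFactor_pos u₂ p
  have h' := nonpos_of_mul_nonpos_right (nonpos_of_mul_nonpos_right h (exp_pos _))
    (by positivity)
  set a := pdx u₁ p / areaFactor u₁ p - pdx u₂ p / areaFactor u₂ p with ha
  set b := pdt u₁ p / areaFactor u₁ p - pdt u₂ p / areaFactor u₂ p with hb
  set d := 1 / areaFactor u₁ p - 1 / areaFactor u₂ p with hd
  have ha0 : a = 0 := by nlinarith [sq_nonneg a, sq_nonneg b, sq_nonneg d]
  have hb0 : b = 0 := by nlinarith [sq_nonneg a, sq_nonneg b, sq_nonneg d]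
  have hd0 : d = 0 := by nlinarith [sq_nonneg a, sq_nonneg b, sq_nonneg d]
  have hW : areaFactor u₁ p = areaFactor u₂ p := by
    rw [hd, sub_eq_zero, one_div, one_div] at hd0
    exact inv_injective hd0
  rw [ha, hW, ← sub_div, div_eq_zero_iff, or_iff_left p2.ne', sub_eq_zero] at ha0
  rw [hb, hW, ← sub_div, div_eq_zero_iff, or_iff_left p2.ne', sub_eq_zero] at hb0
  exact ⟨ha0, hb0⟩

/-! ### The weak maximum principle -/

lemma expNegInvGlue_le_one (s : ℝ) : expNegInvGlue s ≤ 1 := by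
  rcases le_or_gt s 0 with h | h
  · simp [expNegInvGlue.zero_of_nonpos h]
  · rw [expNegInvGlue, if_neg (not_le.2 h), exp_le_one_iff]
    have : 0 < s⁻¹ := inv_pos.2 h
    linarith

lemma deriv_expNegInvGlue_pos {s : ℝ} (hs : 0 < s) : 0 < deriv expNegInvGlue s := by
  have h1 : HasDerivAt (fun r : ℝ => exp (-r⁻¹)) (exp (-s⁻¹) * (s ^ 2)⁻¹) s := by
    simpa using (hasDerivAt_inv hs.ne').fun_neg.exp
  have h2 : expNegInvGlue =ᶠ[𝓝 s] fun r : ℝ => exp (-r⁻¹) := by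
    filter_upwards [lt_mem_nhds hs] with r hr
    rw [expNegInvGlue, if_neg (not_le.2 hr)]
  rw [h2.deriv_eq, h1.deriv]
  positivity

lemma contDiff_expNegInvGlue_one : ContDiff ℝ 1 expNegInvGlue :=
  expNegInvGlue.contDiff (n := 1)

/-- A lower bound for the divergence of the truncated and cut off flux difference. -/
lemma pairing_le_divergence {c : ℝ} {Ω : Set (ℝ × ℝ)} (hΩ : IsOpen Ω) {u₁ u₂ η : ℝ × ℝ → ℝ}
    (h₁ : IsTranslator c Ω u₁) (h₂ : IsTranslator c Ω u₂) (hη : ContDiff ℝ 1 η) (ε : ℝ)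
    {p : ℝ × ℝ} (hp : p ∈ Ω) :
    η p * (deriv expNegInvGlue (u₁ p - u₂ p - ε) * fluxPairing c u₁ u₂ p)
      ≤ pdx (fun q => η q * (expNegInvGlue (u₁ q - u₂ q - ε) * (fluxX c u₁ q - fluxX c u₂ q))) p
        + pdt (fun q => η q * (expNegInvGlue (u₁ q - u₂ q - ε) * (fluxT c u₁ q - fluxT c u₂ q))) p
        + 2 * exp (c * p.2) * gradNorm η p := by
  have hC₁ := h₁.contDiffAt hΩ hp
  have hC₂ := h₂.contDiffAt hΩ hp
  have d1 : DifferentiableAt ℝ u₁ p := hC₁.differentiableAt (by norm_num)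
  have d2 : DifferentiableAt ℝ u₂ p := hC₂.differentiableAt (by norm_num)
  have dη : DifferentiableAt ℝ η p := hη.differentiable (by norm_num) p
  have dX1 : DifferentiableAt ℝ (fluxX c u₁) p := (hC₁.fluxX c).differentiableAt (by norm_num)
  have dX2 : DifferentiableAt ℝ (fluxX c u₂) p := (hC₂.fluxX c).differentiableAt (by norm_num)
  have dT1 : DifferentiableAt ℝ (fluxT c u₁) p := (hC₁.fluxT c).differentiableAt (by norm_num)
  have dT2 : DifferentiableAt ℝ (fluxT c u₂) p := (hC₂.fluxT c).differentiableAt (by norm_num)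
  have dw : HasFDerivAt (fun q => u₁ q - u₂ q - ε) (fderiv ℝ u₁ p - fderiv ℝ u₂ p) p :=
    (d1.hasFDerivAt.fun_sub d2.hasFDerivAt).sub_const ε
  have dg := (contDiff_expNegInvGlue_one.differentiable (by norm_num)
    (u₁ p - u₂ p - ε)).hasDerivAt.comp_hasFDerivAt p dw
  have hG : ∀ a, fderiv ℝ (fun q => expNegInvGlue (u₁ q - u₂ q - ε)) p a
      = deriv expNegInvGlue (u₁ p - u₂ p - ε) * (fderiv ℝ u₁ p a - fderiv ℝ u₂ p a) := by
    intro a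
    rw [HasFDerivAt.fderiv (f := fun q => expNegInvGlue (u₁ q - u₂ q - ε)) dg]
    simp
  have dG : DifferentiableAt ℝ (fun q => expNegInvGlue (u₁ q - u₂ q - ε)) p := dg.differentiableAt
  have key : ∀ (f₁ f₂ : ℝ × ℝ → ℝ) (a : ℝ × ℝ), DifferentiableAt ℝ f₁ p →
      DifferentiableAt ℝ f₂ p →
      fderiv ℝ (fun q => η q * (expNegInvGlue (u₁ q - u₂ q - ε) * (f₁ q - f₂ q))) p a
        = fderiv ℝ η p a * (expNegInvGlue (u₁ p - u₂ p - ε) * (f₁ p - f₂ p))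
          + η p * (deriv expNegInvGlue (u₁ p - u₂ p - ε) * (fderiv ℝ u₁ p a - fderiv ℝ u₂ p a)
            * (f₁ p - f₂ p)
            + expNegInvGlue (u₁ p - u₂ p - ε) * (fderiv ℝ f₁ p a - fderiv ℝ f₂ p a)) := by
    intro f₁ f₂ a hf₁ hf₂
    rw [fderiv_mul_pair_apply dη (dG.fun_mul (hf₁.fun_sub hf₂)),
      fderiv_mul_pair_apply dG (hf₁.fun_sub hf₂), hG, fderiv_sub_apply' hf₁ hf₂]
  have kX := key (fluxX c u₁) (fluxX c u₂) (1, 0) dX1 dX2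
  have kT := key (fluxT c u₁) (fluxT c u₂) (0, 1) dT1 dT2
  have div1 := h₁.div_flux_eq_zero hΩ hp
  have div2 := h₂.div_flux_eq_zero hΩ hp
  have hg0 := expNegInvGlue.nonneg (u₁ p - u₂ p - ε)
  have hg1 := expNegInvGlue_le_one (u₁ p - u₂ p - ε)
  have bound : ∀ a g f₁ f₂ M : ℝ, 0 ≤ g → g ≤ 1 → |f₁| ≤ M → |f₂| ≤ M →
      -(2 * M * |a|) ≤ a * (g * (f₁ - f₂)) := by
    intro a g f₁ f₂ M hg hg' h1 h2
    have h3 : |f₁ - f₂| ≤ 2 * M := (abs_sub _ _).trans (by linarith)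
    have h4 : |g * (f₁ - f₂)| ≤ 2 * M := by
      rw [abs_mul, abs_of_nonneg hg]
      exact (mul_le_of_le_one_left (abs_nonneg _) hg').trans h3
    have h5 : |a * (g * (f₁ - f₂))| ≤ 2 * M * |a| := by
      rw [abs_mul, mul_comm]
      exact mul_le_mul_of_nonneg_right h4 (abs_nonneg _)
    exact (abs_le.1 h5).1
  have bX := bound (pdx η p) _ _ _ _ hg0 hg1 (abs_fluxX_le c u₁ p) (abs_fluxX_le c u₂ p)
  have bT := bound (pdt η p) _ _ _ _ hg0 hg1 (abs_fluxT_le c u₁ p) (abs_fluxT_le c u₂ p)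
  change pdx _ p = pdx η p * _ + η p * (_ * (pdx u₁ p - pdx u₂ p) * _
    + _ * (pdx (fluxX c u₁) p - pdx (fluxX c u₂) p)) at kX
  change pdt _ p = pdt η p * _ + η p * (_ * (pdt u₁ p - pdt u₂ p) * _
    + _ * (pdt (fluxT c u₁) p - pdt (fluxT c u₂) p)) at kT
  rw [kX, kT, gradNorm, fluxPairing]
  have hdiv : η p * (expNegInvGlue (u₁ p - u₂ p - ε)
      * ((pdx (fluxX c u₁) p - pdx (fluxX c u₂) p)
        + (pdt (fluxT c u₁) p - pdt (fluxT c u₂) p))) = 0 := by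
    have : (pdx (fluxX c u₁) p - pdx (fluxX c u₂) p)
        + (pdt (fluxT c u₁) p - pdt (fluxT c u₂) p) = 0 := by linarith
    rw [this]; ring
  linarith

lemma contDiff_indicator_of_eventually_eq_zero {Ω : Set (ℝ × ℝ)} (hΩ : IsOpen Ω)
    {F : ℝ × ℝ → ℝ} (hF : ∀ p ∈ Ω, ContDiffAt ℝ 1 F p)
    (hz : ∀ p ∉ Ω, ∀ᶠ x in 𝓝 p, x ∈ Ω → F x = 0) : ContDiff ℝ 1 (Ω.indicator F) := by
  refine contDiff_iff_contDiffAt.2 fun p => ?_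
  by_cases hp : p ∈ Ω
  · refine (hF p hp).congr_of_eventuallyEq ?_
    filter_upwards [hΩ.mem_nhds hp] with x hx using indicator_of_mem hx F
  · refine (contDiffAt_const (c := (0 : ℝ))).congr_of_eventuallyEq ?_
    filter_upwards [hz p hp] with x hx
    by_cases hxΩ : x ∈ Ω
    · rw [indicator_of_mem hxΩ, hx hxΩ]
    · exact indicator_of_notMem hxΩ F

lemma eventually_sub_lt_of_liminf {Ω : Set (ℝ × ℝ)} {u₁ u₂ : ℝ × ℝ → ℝ} {q : ℝ × ℝ}
    (h : (0 : EReal) ≤ Filter.liminf (fun x => ((u₂ x - u₁ x : ℝ) : EReal)) (𝓝[Ω] q))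
    {ε : ℝ} (hε : 0 < ε) : ∀ᶠ x in 𝓝 q, x ∈ Ω → u₁ x - u₂ x < ε := by
  have h' : ((-ε : ℝ) : EReal) < Filter.liminf (fun x => ((u₂ x - u₁ x : ℝ) : EReal)) (𝓝[Ω] q) :=
    lt_of_lt_of_le (by exact_mod_cast neg_lt_zero.2 hε) h
  have h2 := eventually_nhdsWithin_iff.1 (Filter.eventually_lt_of_lt_liminf h')
  filter_upwards [h2] with x hx hxΩ
  have := EReal.coe_lt_coe_iff.1 (hx hxΩ)
  linarith

/-- The gradients of two translators agree where the difference exceeds the boundary values. -/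
lemma grad_eq_of_lt {c : ℝ} {Ω : Set (ℝ × ℝ)} (hΩo : IsOpen Ω) (hΩb : Bornology.IsBounded Ω)
    {E : Set (ℝ × ℝ)} (hEfin : E.Finite) (hEsub : E ⊆ frontier Ω) {u₁ u₂ : ℝ × ℝ → ℝ}
    (h₁ : IsTranslator c Ω u₁) (h₂ : IsTranslator c Ω u₂)
    (hbdry : ∀ q ∈ frontier Ω \ E,
      (0 : EReal) ≤ Filter.liminf (fun x => ((u₂ x - u₁ x : ℝ) : EReal)) (𝓝[Ω] q))
    {p₀ : ℝ × ℝ} (hp₀ : p₀ ∈ Ω) (hlt : u₂ p₀ < u₁ p₀) :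
    pdx u₁ p₀ = pdx u₂ p₀ ∧ pdt u₁ p₀ = pdt u₂ p₀ := by
  refine grad_eq_of_fluxPairing_le_zero (c := c) ?_
  by_contra! hpos
  obtain ⟨ε, hε, hεlt⟩ : ∃ ε : ℝ, 0 < ε ∧ ε < u₁ p₀ - u₂ p₀ :=
    exists_between (sub_pos.2 hlt)
  set D : ℝ × ℝ → ℝ := fun p =>
    deriv expNegInvGlue (u₁ p - u₂ p - ε) * fluxPairing c u₁ u₂ p with hD
  have hD0 : ∀ p, 0 ≤ D p := fun p =>
    mul_nonneg (expNegInvGlue.monotone.deriv_nonneg) (fluxPairing_nonneg c u₁ u₂ p)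
  have hDp₀ : 0 < D p₀ := mul_pos (deriv_expNegInvGlue_pos (by linarith)) hpos
  have hC₁ := fun p (hp : p ∈ Ω) => h₁.contDiffAt hΩo hp
  have hC₂ := fun p (hp : p ∈ Ω) => h₂.contDiffAt hΩo hp
  have hDc : ContinuousAt D p₀ := by
    have c1 := hC₁ p₀ hp₀
    have c2 := hC₂ p₀ hp₀
    have hg : Continuous (deriv expNegInvGlue) :=
      contDiff_expNegInvGlue_one.continuous_deriv (by norm_num)
    refine ContinuousAt.mul (ContinuousAt.comp (g := deriv expNegInvGlue) hg.continuousAt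
      ((c1.continuousAt.sub c2.continuousAt).sub continuousAt_const)) ?_
    exact ((c1.pdx.continuousAt.sub c2.pdx.continuousAt).mul
      ((c1.fluxX c).continuousAt.sub (c2.fluxX c).continuousAt)).add
      ((c1.pdt.continuousAt.sub c2.pdt.continuousAt).mul
      ((c1.fluxT c).continuousAt.sub (c2.fluxT c).continuousAt))
  have hp₀E : p₀ ∉ E := fun h => by
    have := hEsub h
    rw [hΩo.frontier_eq] at this
    exact this.2 hp₀
  obtain ⟨r, hr, hcut⟩ := exists_cutoff hEfin hp₀E
  obtain ⟨s, hs, hsball⟩ : ∃ s > 0, Metric.ball p₀ s ⊆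
      Metric.ball p₀ r ∩ Ω ∩ {p | D p₀ / 2 < D p} := by
    refine Metric.mem_nhds_iff.1 (inter_mem (inter_mem (Metric.ball_mem_nhds p₀ hr)
      (hΩo.mem_nhds hp₀)) ?_)
    exact hDc.eventually (lt_mem_nhds (half_lt_self hDp₀))
  obtain ⟨M, hM⟩ : ∃ M, ∀ p ∈ Ω, 2 * exp (c * p.2) ≤ M := by
    have hcomp : IsCompact (closure Ω) := hΩb.isCompact_closure
    obtain ⟨M, hM⟩ := (hcomp.image (f := fun p : ℝ × ℝ => 2 * exp (c * p.2))
      (by fun_prop)).bddAbove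
    exact ⟨M, fun p hp => hM ⟨p, subset_closure hp, rfl⟩⟩
  have hM0 : 0 < M := lt_of_lt_of_le (by positivity) (hM p₀ hp₀)
  set A : ℝ := volume.real (Metric.ball p₀ s) * (D p₀ / 2) with hA
  have hApos : 0 < A := by
    refine mul_pos ?_ (half_pos hDp₀)
    exact ENNReal.toReal_pos (Metric.measure_ball_pos volume p₀ hs).ne' measure_ball_lt_top.ne
  obtain ⟨η, hη, hη01, hηE, hηb, hηi, hηκ⟩ := hcut (A / (2 * M)) (by positivity)
  have hzero : ∀ (Y : ℝ × ℝ → ℝ), ∀ p ∉ Ω, ∀ᶠ x in 𝓝 p, x ∈ Ω →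
      η x * (expNegInvGlue (u₁ x - u₂ x - ε) * Y x) = 0 := by
    intro Y p hp
    by_cases hcl : p ∈ closure Ω
    · by_cases hpE : p ∈ E
      · filter_upwards [hηE p hpE] with x hx _
        rw [hx, zero_mul]
      · have hfr : p ∈ frontier Ω \ E := ⟨by rw [hΩo.frontier_eq]; exact ⟨hcl, hp⟩, hpE⟩
        filter_upwards [eventually_sub_lt_of_liminf (hbdry p hfr) hε] with x hx hxΩ
        rw [expNegInvGlue.zero_of_nonpos (by linarith [hx hxΩ]), zero_mul, mul_zero]
    · filter_upwards [isClosed_closure.isOpen_compl.mem_nhds hcl] with x hx hxΩ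
      exact absurd (subset_closure hxΩ) hx
  have hsmooth : ∀ (Y : ℝ × ℝ → ℝ), (∀ p ∈ Ω, ContDiffAt ℝ 1 Y p) → ∀ p ∈ Ω,
      ContDiffAt ℝ 1 (fun x => η x * (expNegInvGlue (u₁ x - u₂ x - ε) * Y x)) p := by
    intro Y hY p hp
    have c1 := (hC₁ p hp).of_le (m := 1) (by norm_num)
    have c2 := (hC₂ p hp).of_le (m := 1) (by norm_num)
    exact hη.contDiffAt.mul ((contDiff_expNegInvGlue_one.contDiffAt.comp p
      ((c1.sub c2).sub contDiffAt_const)).mul (hY p hp))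
  set FX : ℝ × ℝ → ℝ := fun x =>
    η x * (expNegInvGlue (u₁ x - u₂ x - ε) * (fluxX c u₁ x - fluxX c u₂ x)) with hFX
  set FT : ℝ × ℝ → ℝ := fun x =>
    η x * (expNegInvGlue (u₁ x - u₂ x - ε) * (fluxT c u₁ x - fluxT c u₂ x)) with hFT
  have hcs : ∀ F : ℝ × ℝ → ℝ, HasCompactSupport (Ω.indicator F) := fun F =>
    HasCompactSupport.of_support_subset_isCompact hΩb.isCompact_closure
      (Set.support_indicator_subset.trans subset_closure)
  have hXs : ContDiff ℝ 1 (Ω.indicator FX) :=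
    contDiff_indicator_of_eventually_eq_zero hΩo
      (hsmooth _ fun p hp => ((hC₁ p hp).fluxX c).sub ((hC₂ p hp).fluxX c)) (hzero _)
  have hTs : ContDiff ℝ 1 (Ω.indicator FT) :=
    contDiff_indicator_of_eventually_eq_zero hΩo
      (hsmooth _ fun p hp => ((hC₁ p hp).fluxT c).sub ((hC₂ p hp).fluxT c)) (hzero _)
  obtain ⟨hXi, hX0⟩ := integral_fderiv_eq_zero hXs (hcs FX) (1, 0)
  obtain ⟨hTi, hT0⟩ := integral_fderiv_eq_zero hTs (hcs FT) (0, 1)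
  have hdiv : ∀ p ∉ Ω, ∀ F : ℝ × ℝ → ℝ, (∀ᶠ x in 𝓝 p, x ∈ Ω → F x = 0) →
      fderiv ℝ (Ω.indicator F) p = 0 := by
    intro p _ F hF
    have : Ω.indicator F =ᶠ[𝓝 p] fun _ => 0 := by
      filter_upwards [hF] with x hx
      by_cases hxΩ : x ∈ Ω
      · rw [indicator_of_mem hxΩ, hx hxΩ]
      · exact indicator_of_notMem hxΩ F
    rw [this.fderiv_eq]; simp
  have hin : ∀ p ∈ Ω, ∀ F : ℝ × ℝ → ℝ, fderiv ℝ (Ω.indicator F) p = fderiv ℝ F p := by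
    intro p hp F
    refine Filter.EventuallyEq.fderiv_eq ?_
    filter_upwards [hΩo.mem_nhds hp] with x hx using indicator_of_mem hx F
  have hgn : ∀ p, 0 ≤ gradNorm η p := fun p => by unfold gradNorm; positivity
  have hpt : ∀ p, (Metric.ball p₀ s).indicator (fun _ => D p₀ / 2) p ≤
      fderiv ℝ (Ω.indicator FX) p (1, 0) + fderiv ℝ (Ω.indicator FT) p (0, 1)
        + M * gradNorm η p := by
    intro p
    by_cases hp : p ∈ Ω
    · rw [hin p hp, hin p hp]
      have hle := pairing_le_divergence hΩo h₁ h₂ hη ε hp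
      have hMg := mul_le_mul_of_nonneg_right (hM p hp) (hgn p)
      refine le_trans ?_ (hle.trans (add_le_add le_rfl hMg))
      by_cases hb : p ∈ Metric.ball p₀ s
      · rw [indicator_of_mem hb, hηb p (hsball hb).1.1, one_mul]
        exact (hsball hb).2.le
      · rw [indicator_of_notMem hb]
        exact mul_nonneg (hη01 p).1 (hD0 p)
    · have hb : p ∉ Metric.ball p₀ s := fun hb => hp (hsball hb).1.2
      rw [indicator_of_notMem hb, hdiv p hp FX (hzero _ p hp), hdiv p hp FT (hzero _ p hp)]
      simpa using mul_nonneg hM0.le (hgn p)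
  have hint := integral_mono (μ := volume) ((integrable_indicator_iff measurableSet_ball).2
    (integrableOn_const measure_ball_lt_top.ne)) ((hXi.add hTi).add (hηi.const_mul M)) hpt
  rw [integral_indicator measurableSet_ball, setIntegral_const,
    integral_add' (hXi.add hTi) (hηi.const_mul M), integral_add' hXi hTi, hX0, hT0,
    integral_const_mul, smul_eq_mul, ← hA] at hint
  have h3 : M * ∫ x, gradNorm η x ≤ M * (A / (2 * M)) := mul_le_mul_of_nonneg_left hηκ hM0.le
  have h4 : M * (A / (2 * M)) = A / 2 := by field_simp
  linarith

lemma frontier_infinite_of_isBounded {Ω : Set (ℝ × ℝ)} (hΩb : Bornology.IsBounded Ω)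
    (hΩo : IsOpen Ω) (hne : Ω.Nonempty) : (frontier Ω).Infinite := by
  intro hfin
  have hrank : 1 < Module.rank ℝ (ℝ × ℝ) := by
    rw [rank_prod', Module.rank_self]; norm_num
  have hconn := (hfin.countable.isConnected_compl_of_one_lt_rank hrank).isPreconnected
  have hsub : (frontier Ω)ᶜ ⊆ Ω := by
    refine hconn.subset_of_closure_inter_subset hΩo ?_ ?_
    · obtain ⟨x, hx⟩ := hne
      exact ⟨x, by rw [hΩo.frontier_eq]; exact fun h => h.2 hx, hx⟩
    · rintro x ⟨hx, hxf⟩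
      by_contra hxΩ
      exact hxf (by rw [hΩo.frontier_eq]; exact ⟨hx, hxΩ⟩)
  have hb : Bornology.IsBounded (univ : Set (ℝ × ℝ)) := by
    refine (hΩb.union hfin.isBounded).subset fun x _ => ?_
    by_cases hx : x ∈ frontier Ω
    · exact Or.inr hx
    · exact Or.inl (hsub hx)
  exact NormedSpace.unbounded_univ ℝ (ℝ × ℝ) hb

lemma translator_le {c : ℝ} {Ω : Set (ℝ × ℝ)} (hΩo : IsOpen Ω) (hΩb : Bornology.IsBounded Ω)
    (hΩc : IsConnected Ω) {E : Set (ℝ × ℝ)} (hEfin : E.Finite) (hEsub : E ⊆ frontier Ω)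
    {u₁ u₂ : ℝ × ℝ → ℝ} (h₁ : IsTranslator c Ω u₁) (h₂ : IsTranslator c Ω u₂)
    (hbdry : ∀ q ∈ frontier Ω \ E,
      (0 : EReal) ≤ Filter.liminf (fun x => ((u₂ x - u₁ x : ℝ) : EReal)) (𝓝[Ω] q)) :
    ∀ p ∈ Ω, u₁ p ≤ u₂ p := by
  intro p₀ hp₀
  by_contra! hlt
  set w : ℝ × ℝ → ℝ := fun p => u₁ p - u₂ p with hw
  have hdiff : ∀ p ∈ Ω, DifferentiableAt ℝ u₁ p ∧ DifferentiableAt ℝ u₂ p := fun p hp =>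
    ⟨(h₁.contDiffAt hΩo hp).differentiableAt (by norm_num),
      (h₂.contDiffAt hΩo hp).differentiableAt (by norm_num)⟩
  have hwc : ContinuousOn w Ω := fun p hp =>
    ((hdiff p hp).1.sub (hdiff p hp).2).continuousAt.continuousWithinAt
  have hPo : IsOpen (Ω ∩ w ⁻¹' Ioi 0) := hwc.isOpen_inter_preimage hΩo isOpen_Ioi
  have hUo := hPo.isOpen_inter_preimage_of_fderiv_eq_zero (𝕜 := ℝ) (f := w)
    (fun p hp => ((hdiff p hp.1).1.sub (hdiff p hp.1).2).differentiableWithinAt)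
    (fun p hp => by
      obtain ⟨hx, ht⟩ := grad_eq_of_lt hΩo hΩb hEfin hEsub h₁ h₂ hbdry hp.1
        (sub_pos.1 hp.2)
      refine ContinuousLinearMap.ext fun v => ?_
      obtain ⟨a, b⟩ := v
      change fderiv ℝ (fun q => u₁ q - u₂ q) p (a, b) = 0
      rw [fderiv_sub_apply' (hdiff p hp.1).1 (hdiff p hp.1).2, fderiv_pair_apply,
        fderiv_pair_apply, hx, ht, sub_self]) {w p₀}
  have hw₀ : 0 < w p₀ := sub_pos.2 hlt
  have hsub : Ω ⊆ Ω ∩ w ⁻¹' Ioi 0 ∩ w ⁻¹' {w p₀} := by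
    refine hΩc.isPreconnected.subset_of_closure_inter_subset hUo ⟨p₀, hp₀, ⟨hp₀, hw₀⟩, rfl⟩ ?_
    rintro x ⟨hx, hxΩ⟩
    have hxw : w x = w p₀ := by
      have hcx : ContinuousWithinAt w (Ω ∩ w ⁻¹' Ioi 0 ∩ w ⁻¹' {w p₀}) x :=
        ((hdiff x hxΩ).1.sub (hdiff x hxΩ).2).continuousAt.continuousWithinAt
      have := hcx.mem_closure hx (t := {w p₀}) fun y hy => hy.2
      simpa using this
    exact ⟨⟨hxΩ, by simpa [hxw] using hw₀⟩, hxw⟩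
  obtain ⟨q, hq, hqE⟩ := (frontier_infinite_of_isBounded hΩb hΩo hΩc.nonempty).exists_notMem_finite
    hEfin
  have hev := eventually_sub_lt_of_liminf (hbdry q ⟨hq, hqE⟩) hw₀
  have hfreq := mem_closure_iff_frequently.1 (frontier_subset_closure hq)
  obtain ⟨x, hxΩ, hx⟩ := (hfreq.and_eventually hev).exists
  have h1 : w x = w p₀ := (hsub hxΩ).2
  have h2 : w x < w p₀ := hx hxΩ
  linarith

/-! ### The strong maximum principle -/

lemma IsTranslator.eq_of_le_of_eq {c : ℝ} {Ω : Set (ℝ × ℝ)} (hΩo : IsOpen Ω)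
    (hΩc : IsPreconnected Ω) {u₁ u₂ : ℝ × ℝ → ℝ} (h₁ : IsTranslator c Ω u₁)
    (h₂ : IsTranslator c Ω u₂) (hle : ∀ p ∈ Ω, u₁ p ≤ u₂ p) {p₀ : ℝ × ℝ} (hp₀ : p₀ ∈ Ω)
    (h₀ : u₂ p₀ = u₁ p₀) : EqOn u₁ u₂ Ω := by
  have hC₁ := fun p (hp : p ∈ Ω) => h₁.contDiffAt hΩo hp
  have hC₂ := fun p (hp : p ∈ Ω) => h₂.contDiffAt hΩo hp
  have x₁ : ContinuousOn (pdx u₁) Ω := fun p hp => (hC₁ p hp).pdx.continuousAt.continuousWithinAt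
  have x₂ : ContinuousOn (pdx u₂) Ω := fun p hp => (hC₂ p hp).pdx.continuousAt.continuousWithinAt
  have t₁ : ContinuousOn (pdt u₁) Ω := fun p hp => (hC₁ p hp).pdt.continuousAt.continuousWithinAt
  have t₂ : ContinuousOn (pdt u₂) Ω := fun p hp => (hC₂ p hp).pdt.continuousAt.continuousWithinAt
  have xx : ContinuousOn (pdx (pdx u₁)) Ω := fun p hp =>
    ((hC₁ p hp).pdx.continuousAt_fderiv_apply (1, 0)).continuousWithinAt
  have xt : ContinuousOn (pdx (pdt u₁)) Ω := fun p hp =>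
    ((hC₁ p hp).pdt.continuousAt_fderiv_apply (1, 0)).continuousWithinAt
  have tt : ContinuousOn (pdt (pdt u₁)) Ω := fun p hp =>
    ((hC₁ p hp).pdt.continuousAt_fderiv_apply (0, 1)).continuousWithinAt
  have key := eq_zero_of_nonneg_of_elliptic hΩo hΩc (w := fun p => u₂ p - u₁ p)
    (n₁ := pdt u₂) (n₂ := fun p => -pdx u₂ p)
    (b₁ := fun p => -2 * pdt u₁ p * pdx (pdt u₁) p + (pdx u₂ p + pdx u₁ p) * pdt (pdt u₁) p
      + c * pdt u₁ p * (pdx u₂ p + pdx u₁ p))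
    (b₂ := fun p => (pdt u₂ p + pdt u₁ p) * pdx (pdx u₁) p - 2 * pdx u₂ p * pdx (pdt u₁) p
      + c * (1 + pdx u₂ p ^ 2 + pdt u₂ p ^ 2) + c * pdt u₁ p * (pdt u₂ p + pdt u₁ p))
    (fun p hp => (hC₂ p hp).sub (hC₁ p hp)) t₂ x₂.neg (by fun_prop) (by fun_prop)
    (fun p hp => by
      have exx : pdx (pdx fun q => u₂ q - u₁ q) p = pdx (pdx u₂) p - pdx (pdx u₁) p :=
        fderiv_fderiv_sub_apply (hC₂ p hp) (hC₁ p hp) _ _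
      have exT : pdx (pdt fun q => u₂ q - u₁ q) p = pdx (pdt u₂) p - pdx (pdt u₁) p :=
        fderiv_fderiv_sub_apply (hC₂ p hp) (hC₁ p hp) _ _
      have ett : pdt (pdt fun q => u₂ q - u₁ q) p = pdt (pdt u₂) p - pdt (pdt u₁) p :=
        fderiv_fderiv_sub_apply (hC₂ p hp) (hC₁ p hp) _ _
      have d₁ := (hC₁ p hp).differentiableAt (by norm_num)
      have d₂ := (hC₂ p hp).differentiableAt (by norm_num)
      have ex : pdx (fun q => u₂ q - u₁ q) p = pdx u₂ p - pdx u₁ p := fderiv_sub_apply' d₂ d₁ _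
      have et : pdt (fun q => u₂ q - u₁ q) p = pdt u₂ p - pdt u₁ p := fderiv_sub_apply' d₂ d₁ _
      rw [exx, exT, ett, ex, et]
      linear_combination h₂.2 p hp - h₁.2 p hp)
    (fun p hp => sub_nonneg.2 (hle p hp)) hp₀ (sub_eq_zero.2 h₀)
  exact fun p hp => (sub_eq_zero.1 (key p hp)).symm

/-- Maximum principle for graphical translators: if `u₁, u₂` are c-translator solutions
on a bounded open connected set `Ω` and `liminf (u₂ - u₁) ≥ 0` at every boundary point
outside a finite exceptional set `E ⊂ ∂Ω`, then `u₂ ≥ u₁` on `Ω`, with equality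
everywhere as soon as it holds at one point. -/
theorem translator_maximum_principle (c : ℝ) (Ω : Set (ℝ × ℝ))
    (hΩo : IsOpen Ω) (hΩb : Bornology.IsBounded Ω) (hΩc : IsConnected Ω)
    (E : Set (ℝ × ℝ)) (hEfin : E.Finite) (hEsub : E ⊆ frontier Ω)
    (u₁ u₂ : ℝ × ℝ → ℝ)
    (h₁ : IsTranslator c Ω u₁) (h₂ : IsTranslator c Ω u₂)
    (hbdry : ∀ q ∈ frontier Ω \ E,
      (0 : EReal) ≤ Filter.liminf (fun x => ((u₂ x - u₁ x : ℝ) : EReal)) (𝓝[Ω] q)) :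
    (∀ p ∈ Ω, u₁ p ≤ u₂ p) ∧
    (∀ p ∈ Ω, u₂ p = u₁ p → Set.EqOn u₁ u₂ Ω) := by
  have hle := translator_le hΩo hΩb hΩc hEfin hEsub h₁ h₂ hbdry
  exact ⟨hle, fun p hp h => h₁.eq_of_le_of_eq hΩo hΩc.isPreconnected h₂ hle hp h⟩
end

section
/- Interior gradient estimate: let c ∈ ℝ, let Ω ⊆ ℝ² be open, and let (u_n) be a sequence of c-translator solutions on Ω. Let p ∈ Ω and r > 0 be such that the closed Euclidean ball of radius 2r centered at p is contained in Ω, and suppose there is K > 0 with |u_n(q)| ≤ K for all n ∈ ℕ and all q in the ball B_{2r}(p). Then there exists a constant C > 0 such that sup_{q ∈ B_r(p)} |∇u_n(q)| ≤ C for all n ∈ ℕ. -/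
open Real Set Filter Topology

/-- The Euclidean distance on ℝ². -/
noncomputable def eDist (p q : ℝ × ℝ) : ℝ :=
  Real.sqrt ((p.1 - q.1) ^ 2 + (p.2 - q.2) ^ 2)

/-- Second-order necessary condition at a local maximum of a function of one variable. -/
theorem IsLocalMax.deriv_eq_zero_and_second_deriv_nonpos {G G' : ℝ → ℝ} {A a : ℝ}
    (hG : ∀ᶠ t in 𝓝 a, HasDerivAt G (G' t) t) (hG' : HasDerivAt G' A a)
    (hmax : IsLocalMax G a) : G' a = 0 ∧ A ≤ 0 := by
  have h0 : G' a = 0 := hmax.hasDerivAt_eq_zero hG.self_of_nhds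
  refine ⟨h0, ?_⟩
  by_contra! hA
  have hd : deriv G =ᶠ[𝓝 a] G' := hG.mono fun t ht => ht.deriv
  have hmin : IsLocalMin G a := by
    refine isLocalMin_of_deriv_deriv_pos ?_ ?_ hG.self_of_nhds.continuousAt
    · rw [hd.deriv_eq, hG'.deriv]; exact hA
    · rw [hG.self_of_nhds.deriv, h0]
  have hconst : G =ᶠ[𝓝 a] fun _ => G a := by
    filter_upwards [hmax, hmin] with t h1 h2
    exact le_antisymm h1 h2
  have h1 : deriv G =ᶠ[𝓝 a] fun _ => 0 := by
    have := hconst.deriv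
    simpa using this
  have h2 : G' =ᶠ[𝓝 a] fun _ => 0 := hd.symm.trans h1
  have h3 := h2.deriv_eq
  rw [hG'.deriv] at h3
  simp at h3
  exact hA.ne' h3

/-- First and second derivative relations at a local maximum of `w * φ ^ m`. -/
theorem IsLocalMax.mul_pow_conditions {w w' φ φ' : ℝ → ℝ} {w'' φ'' : ℝ} (m : ℕ)
    (hw : ∀ᶠ t in 𝓝 0, HasDerivAt w (w' t) t) (hw' : HasDerivAt w' w'' 0)
    (hφ : ∀ᶠ t in 𝓝 0, HasDerivAt φ (φ' t) t) (hφ' : HasDerivAt φ' φ'' 0)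
    (hw0 : 0 < w 0) (hφ0 : 0 < φ 0) (hmax : IsLocalMax (fun t => w t * φ t ^ m) 0) :
    w' 0 * φ 0 = -(m * w 0 * φ' 0) ∧
      w'' * φ 0 ^ 2 ≤ w 0 * (m * (m + 1) * φ' 0 ^ 2 - m * φ 0 * φ'') := by
  have hwpos : ∀ᶠ t in 𝓝 (0 : ℝ), 0 < w t :=
    hw.self_of_nhds.continuousAt.eventually (lt_mem_nhds hw0)
  have hφpos : ∀ᶠ t in 𝓝 (0 : ℝ), 0 < φ t :=
    hφ.self_of_nhds.continuousAt.eventually (lt_mem_nhds hφ0)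
  obtain ⟨h1, h2⟩ := IsLocalMax.deriv_eq_zero_and_second_deriv_nonpos (a := 0)
    (G := fun t => Real.log (w t) + m * Real.log (φ t))
    (G' := fun t => w' t / w t + m * (φ' t / φ t))
    (A := (w'' * w 0 - w' 0 * w' 0) / w 0 ^ 2 + m * ((φ'' * φ 0 - φ' 0 * φ' 0) / φ 0 ^ 2))
    (by
      filter_upwards [hw, hφ, hwpos, hφpos] with t a b c d
      exact (a.log c.ne').add ((b.log d.ne').const_mul _))
    ((hw'.div hw.self_of_nhds hw0.ne').add
      ((hφ'.div hφ.self_of_nhds hφ0.ne').const_mul _))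
    (by
      filter_upwards [hmax, hwpos, hφpos] with t a b c
      have := Real.log_le_log (by positivity) a
      rw [Real.log_mul b.ne' (by positivity), Real.log_mul hw0.ne' (by positivity),
        Real.log_pow, Real.log_pow] at this
      exact this)
  have e1 : w' 0 * φ 0 = -(m * w 0 * φ' 0) := by
    field_simp at h1
    linarith
  refine ⟨e1, ?_⟩
  have e2 : ((w'' * w 0 - w' 0 * w' 0) / w 0 ^ 2
      + m * ((φ'' * φ 0 - φ' 0 * φ' 0) / φ 0 ^ 2)) * (w 0 * φ 0 ^ 2)
      = (w'' * φ 0 ^ 2) - w 0 * (m * (m + 1) * φ' 0 ^ 2 - m * φ 0 * φ'') := by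
    have e3 : w' 0 = -(m * w 0 * φ' 0) / φ 0 := by field_simp; linarith
    rw [e3]
    field_simp
    ring
  have e4 := mul_nonpos_of_nonpos_of_nonneg h2 (by positivity : 0 ≤ w 0 * φ 0 ^ 2)
  linarith

/-- Joint convergence of difference quotients of a strictly differentiable function. -/
theorem HasStrictFDerivAt.tendsto_difference_quotient {E F : Type*} [NormedAddCommGroup E]
    [NormedSpace ℝ E] [NormedAddCommGroup F] [NormedSpace ℝ F] {f : E → F} {f' : E →L[ℝ] F}
    {y e : E} (hf : HasStrictFDerivAt f f' y) {l : Filter ℝ} (hl : l ≤ 𝓝[>] 0) {x : ℝ → E}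
    (hx : Tendsto x l (𝓝 y)) :
    Tendsto (fun ε => ε⁻¹ • (f (x ε + ε • e) - f (x ε))) l (𝓝 (f' e)) := by
  have hε : Tendsto (fun ε : ℝ => ε) l (𝓝 0) := hl.trans nhdsWithin_le_nhds
  have hpos : ∀ᶠ ε in l, (0 : ℝ) < ε := hl self_mem_nhdsWithin
  have hx' : Tendsto (fun ε => x ε + ε • e) l (𝓝 y) := by
    simpa using hx.add (hε.smul_const e)
  have h1 := hf.isLittleO.comp_tendsto (hx'.prodMk_nhds hx)
  have h2 : (fun ε => f (x ε + ε • e) - f (x ε) - ε • f' e) =o[l] fun ε : ℝ => ε := by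
    have h3 : (fun ε : ℝ => ε • e) =O[l] fun ε : ℝ => ε :=
      Asymptotics.IsBigO.of_bound ‖e‖ (Eventually.of_forall fun ε => by
        rw [norm_smul, mul_comm])
    refine (h1.congr ?_ ?_).trans_isBigO h3
    · intro ε; simp
    · intro ε; simp
  have h4 : Tendsto (fun ε => ε⁻¹ • (f (x ε + ε • e) - f (x ε) - ε • f' e)) l (𝓝 0) := by
    exact h2.tendsto_inv_smul_nhds_zero
  have h5 := h4.add_const (f' e)
  rw [zero_add] at h5
  refine h5.congr' ?_
  filter_upwards [hpos] with ε h
  rw [smul_sub, inv_smul_smul₀ h.ne', sub_add_cancel]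

theorem ContDiffOn.hasStrictFDerivAt_fderiv {u : ℝ × ℝ → ℝ} {Ω : Set (ℝ × ℝ)}
    (hu : ContDiffOn ℝ 2 u Ω) (hΩ : IsOpen Ω) {x : ℝ × ℝ} (hx : x ∈ Ω) :
    HasStrictFDerivAt u (fderiv ℝ u x) x ∧
      HasStrictFDerivAt (fderiv ℝ u) (fderiv ℝ (fderiv ℝ u) x) x := by
  have h := hu.contDiffAt (hΩ.mem_nhds hx)
  have h' : ContDiffAt ℝ 1 (fderiv ℝ u) x := h.fderiv_right (by norm_num)
  exact ⟨h.hasStrictFDerivAt (by norm_num), h'.hasStrictFDerivAt (by norm_num)⟩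

theorem ContDiffOn.fderiv_fderiv_comm {u : ℝ × ℝ → ℝ} {Ω : Set (ℝ × ℝ)}
    (hu : ContDiffOn ℝ 2 u Ω) (hΩ : IsOpen Ω) {x : ℝ × ℝ} (hx : x ∈ Ω) (v w : ℝ × ℝ) :
    fderiv ℝ (fderiv ℝ u) x v w = fderiv ℝ (fderiv ℝ u) x w v :=
  ((hu.contDiffAt (hΩ.mem_nhds hx)).isSymmSndFDerivAt (by simp)) v w

/-- First and second derivatives of a `C²` function along a line. -/
theorem ContDiffOn.hasDerivAt_line {u : ℝ × ℝ → ℝ} {Ω : Set (ℝ × ℝ)}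
    (hu : ContDiffOn ℝ 2 u Ω) (hΩ : IsOpen Ω) {x : ℝ × ℝ} (hx : x ∈ Ω) (v : ℝ × ℝ) :
    (∀ᶠ t in 𝓝 (0 : ℝ), HasDerivAt (fun t : ℝ => u (x + t • v)) (fderiv ℝ u (x + t • v) v) t) ∧
      HasDerivAt (fun t : ℝ => fderiv ℝ u (x + t • v) v) (fderiv ℝ (fderiv ℝ u) x v v) 0 := by
  have hline : ∀ t : ℝ, HasDerivAt (fun t : ℝ => x + t • v) v t := fun t => by
    simpa using ((hasDerivAt_id t).smul_const v).const_add x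
  have hmem : ∀ᶠ t in 𝓝 (0 : ℝ), x + t • v ∈ Ω :=
    (hline 0).continuousAt.eventually (by simpa using hΩ.mem_nhds hx)
  constructor
  · filter_upwards [hmem] with t ht
    exact (hu.hasStrictFDerivAt_fderiv hΩ ht).1.hasFDerivAt.comp_hasDerivAt t (hline t)
  · have h := (hu.hasStrictFDerivAt_fderiv hΩ hx).2.hasFDerivAt
    have h2 : HasFDerivAt (fderiv ℝ u) (fderiv ℝ (fderiv ℝ u) x) (x + (0 : ℝ) • v) := by
      simpa using h
    have h3 : HasFDerivAt (fun q => fderiv ℝ u q v) ((fderiv ℝ (fderiv ℝ u) x).flip v)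
        (x + (0 : ℝ) • v) :=
      (h2.clm_apply (hasFDerivAt_const v _)).congr_fderiv (by ext <;> simp)
    exact h3.comp_hasDerivAt (0 : ℝ) (hline 0)

/-- The translator equation written in a rotated orthonormal frame. -/
theorem IsTranslator.equation_frame {c : ℝ} {Ω : Set (ℝ × ℝ)} {u : ℝ × ℝ → ℝ}
    (hu : IsTranslator c Ω u) (hΩ : IsOpen Ω) {x : ℝ × ℝ} (hx : x ∈ Ω) {k l : ℝ}
    (hkl : k ^ 2 + l ^ 2 = 1) {p₁ p₂ A₁₁ A₁₂ A₂₂ : ℝ}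
    (hp₁ : p₁ = fderiv ℝ u x (k, l)) (hp₂ : p₂ = fderiv ℝ u x (-l, k))
    (hA₁₁ : A₁₁ = fderiv ℝ (fderiv ℝ u) x (k, l) (k, l))
    (hA₁₂ : A₁₂ = fderiv ℝ (fderiv ℝ u) x (k, l) (-l, k))
    (hA₂₂ : A₂₂ = fderiv ℝ (fderiv ℝ u) x (-l, k) (-l, k)) :
    (1 + p₂ ^ 2) * A₁₁ - 2 * p₁ * p₂ * A₁₂ + (1 + p₁ ^ 2) * A₂₂
      + (c * l * p₁ + c * k * p₂) * (1 + p₁ ^ 2 + p₂ ^ 2) = 0 := by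
  have hs := (hu.1.hasStrictFDerivAt_fderiv hΩ hx).2.hasFDerivAt
  have h2 : ∀ v w : ℝ × ℝ, fderiv ℝ (fun q => fderiv ℝ u q v) x w
      = fderiv ℝ (fderiv ℝ u) x w v := fun v w => by
    rw [(hs.clm_apply (hasFDerivAt_const v x)).fderiv]
    simp
  have e1 : ((1, 0) : ℝ × ℝ) = k • (k, l) - l • (-l, k) := by
    ext
    · simp; linarith
    · simp; ring
  have e2 : ((0, 1) : ℝ × ℝ) = l • (k, l) + k • (-l, k) := by
    ext
    · simp; ring
    · simp; linarith
  have hsym := hu.1.fderiv_fderiv_comm hΩ hx (-l, k) (k, l)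
  have h := hu.2 x hx
  have f1 : pdx u x = k * p₁ - l * p₂ := by
    rw [pdx, e1, map_sub, map_smul, map_smul, hp₁, hp₂]; rfl
  have f2 : pdt u x = l * p₁ + k * p₂ := by
    rw [pdt, e2, map_add, map_smul, map_smul, hp₁, hp₂]; rfl
  have f3 : pdx (pdx u) x = k ^ 2 * A₁₁ - 2 * k * l * A₁₂ + l ^ 2 * A₂₂ := by
    have : pdx (pdx u) x = fderiv ℝ (fderiv ℝ u) x (1, 0) (1, 0) := h2 _ _
    rw [this, e1]
    simp only [map_sub, map_smul, sub_apply, smul_apply,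
      hsym, ← hA₁₁, ← hA₁₂, ← hA₂₂, smul_eq_mul]
    ring
  have f4 : pdx (pdt u) x = k * l * A₁₁ + (k ^ 2 - l ^ 2) * A₁₂ - k * l * A₂₂ := by
    have : pdx (pdt u) x = fderiv ℝ (fderiv ℝ u) x (1, 0) (0, 1) := h2 _ _
    rw [this, e1, e2]
    simp only [map_sub, map_add, map_smul, sub_apply,
      smul_apply, hsym, ← hA₁₁, ← hA₁₂, ← hA₂₂, smul_eq_mul]
    ring
  have f5 : pdt (pdt u) x = l ^ 2 * A₁₁ + 2 * k * l * A₁₂ + k ^ 2 * A₂₂ := by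
    have : pdt (pdt u) x = fderiv ℝ (fderiv ℝ u) x (0, 1) (0, 1) := h2 _ _
    rw [this, e2]
    simp only [map_add, map_smul, add_apply, smul_apply,
      hsym, ← hA₁₁, ← hA₁₂, ← hA₂₂, smul_eq_mul]
    ring
  rw [f1, f2, f3, f4, f5] at h
  linear_combination h - hkl * ((A₁₁ + A₂₂) + (k ^ 2 + l ^ 2 + 1) *
    (p₂ ^ 2 * A₁₁ - 2 * p₁ * p₂ * A₁₂ + p₁ ^ 2 * A₂₂)
    + c * (l * p₁ + k * p₂) * (p₁ ^ 2 + p₂ ^ 2))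

/-- The barrier combining the height of the graph with a quadratic cutoff. -/
noncomputable def heightCutoff (u : ℝ × ℝ → ℝ) (p : ℝ × ℝ) (a b z : ℝ) (y : ℝ × ℝ) : ℝ :=
  a * u y + (b - z / 2 * ((y.1 - p.1) ^ 2 + (y.2 - p.2) ^ 2))

/-- First and second order conditions at a maximum of a localized difference quotient. -/
theorem ContDiffOn.difference_quotient_max_conditions {u : ℝ × ℝ → ℝ} {Ω : Set (ℝ × ℝ)}
    (hu : ContDiffOn ℝ 2 u Ω) (hΩ : IsOpen Ω) {x e p : ℝ × ℝ} {ε a b z : ℝ} (m : ℕ)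
    (hx : x ∈ Ω) (hxe : x + ε • e ∈ Ω)
    (hW : 0 < ε⁻¹ * (u (x + ε • e) - u x)) (hφ : 0 < heightCutoff u p a b z x)
    (hmax : IsLocalMax
      (fun y => ε⁻¹ * (u (y + ε • e) - u y) * heightCutoff u p a b z y ^ m) x) (v : ℝ × ℝ) :
    ε⁻¹ * (fderiv ℝ u (x + ε • e) v - fderiv ℝ u x v) * heightCutoff u p a b z x
      = -(m * (ε⁻¹ * (u (x + ε • e) - u x)) *
        (a * fderiv ℝ u x v - z * ((x.1 - p.1) * v.1 + (x.2 - p.2) * v.2))) ∧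
    ε⁻¹ * (fderiv ℝ (fderiv ℝ u) (x + ε • e) v v - fderiv ℝ (fderiv ℝ u) x v v)
        * heightCutoff u p a b z x ^ 2
      ≤ ε⁻¹ * (u (x + ε • e) - u x) * (m * (m + 1) *
        (a * fderiv ℝ u x v - z * ((x.1 - p.1) * v.1 + (x.2 - p.2) * v.2)) ^ 2
        - m * heightCutoff u p a b z x *
          (a * fderiv ℝ (fderiv ℝ u) x v v - z * (v.1 ^ 2 + v.2 ^ 2))) := by
  obtain ⟨h1, h2⟩ := hu.hasDerivAt_line hΩ hx v
  obtain ⟨h3, h4⟩ := hu.hasDerivAt_line hΩ hxe v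
  have hlin : ∀ α β t : ℝ, HasDerivAt (fun t : ℝ => α + t * β) β t := fun α β t => by
    simpa using ((hasDerivAt_id t).mul_const β).const_add α
  have hq : ∀ t : ℝ, HasDerivAt
      (fun t : ℝ => b - z / 2 * ((x.1 + t * v.1 - p.1) ^ 2 + (x.2 + t * v.2 - p.2) ^ 2))
      (-(z * ((x.1 + t * v.1 - p.1) * v.1 + (x.2 + t * v.2 - p.2) * v.2))) t := fun t => by
    have := (((((hlin x.1 v.1 t).sub_const p.1).pow 2).add
      (((hlin x.2 v.2 t).sub_const p.2).pow 2)).const_mul (z / 2)).const_sub b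
    refine this.congr_deriv ?_
    norm_num
    ring
  have hq' : HasDerivAt
      (fun t : ℝ => -(z * ((x.1 + t * v.1 - p.1) * v.1 + (x.2 + t * v.2 - p.2) * v.2)))
      (-(z * (v.1 ^ 2 + v.2 ^ 2))) 0 := by
    have := ((((hlin x.1 v.1 0).sub_const p.1).mul_const v.1).add
      (((hlin x.2 v.2 0).sub_const p.2).mul_const v.2)).const_mul z |>.neg
    refine this.congr_deriv ?_
    ring
  have key := IsLocalMax.mul_pow_conditions m
    (w := fun t => ε⁻¹ * (u (x + ε • e + t • v) - u (x + t • v)))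
    (w' := fun t => ε⁻¹ * (fderiv ℝ u (x + ε • e + t • v) v - fderiv ℝ u (x + t • v) v))
    (φ := fun t => a * u (x + t • v) +
      (b - z / 2 * ((x.1 + t * v.1 - p.1) ^ 2 + (x.2 + t * v.2 - p.2) ^ 2)))
    (φ' := fun t => a * fderiv ℝ u (x + t • v) v +
      -(z * ((x.1 + t * v.1 - p.1) * v.1 + (x.2 + t * v.2 - p.2) * v.2)))
    (by filter_upwards [h1, h3] with t a b using (b.sub a).const_mul _)
    ((h4.sub h2).const_mul _)
    (by filter_upwards [h1] with t a using (a.const_mul _).add (hq t))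
    ((h2.const_mul _).add hq')
    (by simpa using hW) (by simpa [heightCutoff] using hφ)
    (by
      have hc : ContinuousAt (fun t : ℝ => x + t • v) 0 := by fun_prop
      have hmax' : ∀ᶠ y in 𝓝 (x + (0 : ℝ) • v),
          ε⁻¹ * (u (y + ε • e) - u y) * heightCutoff u p a b z y ^ m
          ≤ ε⁻¹ * (u (x + ε • e) - u x) * heightCutoff u p a b z x ^ m := by
        rw [zero_smul, add_zero]
        exact hmax
      filter_upwards [hc.eventually hmax'] with t ht
      simpa [heightCutoff, add_right_comm] using ht)
  simpa [heightCutoff, sub_eq_add_neg] using key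

/-- The linearized translator inequality at a maximum of a localized difference quotient, in the
orthonormal frame `(k, l), (-l, k)`. -/
theorem IsTranslator.difference_quotient_max_inequality {c : ℝ} {u : ℝ × ℝ → ℝ}
    {Ω : Set (ℝ × ℝ)} (hu : IsTranslator c Ω u) (hΩ : IsOpen Ω) {x p : ℝ × ℝ}
    {ε a b z k l : ℝ} (m : ℕ) (hε : 0 < ε) (hkl : k ^ 2 + l ^ 2 = 1)
    (hx : x ∈ Ω) (hxe : x + ε • (k, l) ∈ Ω)
    {p₁ p₂ P₁ P₂ q₁ q₂ A₁₁ A₁₂ A₂₂ W φ Φ₁ Φ₂ : ℝ}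
    (hp₁ : p₁ = fderiv ℝ u x (k, l)) (hp₂ : p₂ = fderiv ℝ u x (-l, k))
    (hP₁ : P₁ = fderiv ℝ u (x + ε • (k, l)) (k, l))
    (hP₂ : P₂ = fderiv ℝ u (x + ε • (k, l)) (-l, k))
    (hq₁ : q₁ = ε⁻¹ * (P₁ - p₁)) (hq₂ : q₂ = ε⁻¹ * (P₂ - p₂))
    (hA₁₁ : A₁₁ = fderiv ℝ (fderiv ℝ u) x (k, l) (k, l))
    (hA₁₂ : A₁₂ = fderiv ℝ (fderiv ℝ u) x (k, l) (-l, k))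
    (hA₂₂ : A₂₂ = fderiv ℝ (fderiv ℝ u) x (-l, k) (-l, k))
    (hW : W = ε⁻¹ * (u (x + ε • (k, l)) - u x)) (hφ : φ = heightCutoff u p a b z x)
    (hΦ₁ : Φ₁ = a * p₁ - z * ((x.1 - p.1) * k + (x.2 - p.2) * l))
    (hΦ₂ : Φ₂ = a * p₂ - z * ((x.1 - p.1) * -l + (x.2 - p.2) * k))
    (hW0 : 0 < W) (hφ0 : 0 < φ)
    (hmax : IsLocalMax
      (fun y => ε⁻¹ * (u (y + ε • (k, l)) - u y) * heightCutoff u p a b z y ^ m) x) :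
    q₁ * φ = -(m * W * Φ₁) ∧ q₂ * φ = -(m * W * Φ₂) ∧
    0 ≤ W * (m * (m + 1) * (Φ₁ ^ 2 + Φ₂ ^ 2 + (-P₂ * Φ₁ + P₁ * Φ₂) ^ 2)
        - m * φ * (a * (A₁₁ + A₂₂ + (P₂ ^ 2 * A₁₁ - 2 * P₁ * P₂ * A₁₂ + P₁ ^ 2 * A₂₂))
          - z * (2 + P₁ ^ 2 + P₂ ^ 2)))
      + (q₂ * (P₂ + p₂) * A₁₁ - 2 * (q₁ * P₂ + p₁ * q₂) * A₁₂ + q₁ * (P₁ + p₁) * A₂₂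
        + (c * l * q₁ + c * k * q₂) * (1 + P₁ ^ 2 + P₂ ^ 2)
        + (c * l * p₁ + c * k * p₂) * (q₁ * (P₁ + p₁) + q₂ * (P₂ + p₂))) * φ ^ 2 := by
  set e : ℝ × ℝ := (k, l) with he
  set f : ℝ × ℝ := (-l, k) with hf
  have key := hu.1.difference_quotient_max_conditions hΩ m hx hxe (hW ▸ hW0) (hφ ▸ hφ0) hmax
  rw [← hφ, ← hW] at key
  obtain ⟨t1, t2⟩ := key e
  obtain ⟨t3, t4⟩ := key f
  obtain ⟨-, t6⟩ := key (-P₂ • e + P₁ • f)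
  have hsx := hu.1.fderiv_fderiv_comm hΩ hx f e
  have hsxe := hu.1.fderiv_fderiv_comm hΩ hxe f e
  have E1 := hu.equation_frame hΩ hx hkl hp₁ hp₂ hA₁₁ hA₁₂ hA₂₂
  obtain ⟨B₁₁, hB₁₁⟩ : ∃ B, B = fderiv ℝ (fderiv ℝ u) (x + ε • e) e e := ⟨_, rfl⟩
  obtain ⟨B₁₂, hB₁₂⟩ : ∃ B, B = fderiv ℝ (fderiv ℝ u) (x + ε • e) e f := ⟨_, rfl⟩
  obtain ⟨B₂₂, hB₂₂⟩ : ∃ B, B = fderiv ℝ (fderiv ℝ u) (x + ε • e) f f := ⟨_, rfl⟩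
  have E2 := hu.equation_frame hΩ hxe hkl hP₁ hP₂ hB₁₁ hB₁₂ hB₂₂
  simp only [map_add, map_smul, add_apply, smul_apply, hsx, hsxe, ← hA₁₁, ← hA₁₂, ← hA₂₂,
    ← hB₁₁, ← hB₁₂, ← hB₂₂, ← hp₁, ← hp₂, ← hP₁, ← hP₂, smul_eq_mul] at t1 t2 t3 t4 t6
  simp only [he, hf, Prod.smul_mk, Prod.mk_add_mk, smul_eq_mul] at t1 t2 t3 t4 t6
  rw [← hq₁, ← hΦ₁] at t1
  rw [← hq₂, ← hΦ₂] at t3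
  rw [← hΦ₁] at t2
  rw [← hΦ₂] at t4
  refine ⟨t1, t3, ?_⟩
  have hΦ : a * (-P₂ * p₁ + P₁ * p₂) - z * ((x.1 - p.1) * (-P₂ * k + P₁ * -l)
      + (x.2 - p.2) * (-P₂ * l + P₁ * k)) = -P₂ * Φ₁ + P₁ * Φ₂ := by
    rw [hΦ₁, hΦ₂]; ring
  have hn : (-P₂ * k + P₁ * -l) ^ 2 + (-P₂ * l + P₁ * k) ^ 2 = P₁ ^ 2 + P₂ ^ 2 := by
    linear_combination (P₁ ^ 2 + P₂ ^ 2) * hkl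
  have hn' : (-l) ^ 2 + k ^ 2 = 1 := by linear_combination hkl
  rw [hΦ, hn] at t6
  rw [hkl] at t2
  rw [hn'] at t4
  obtain ⟨T₁₁, hT₁₁⟩ : ∃ T, B₁₁ = A₁₁ + ε * T := ⟨ε⁻¹ * (B₁₁ - A₁₁), by field_simp; ring⟩
  obtain ⟨T₁₂, hT₁₂⟩ : ∃ T, B₁₂ = A₁₂ + ε * T := ⟨ε⁻¹ * (B₁₂ - A₁₂), by field_simp; ring⟩
  obtain ⟨T₂₂, hT₂₂⟩ : ∃ T, B₂₂ = A₂₂ + ε * T := ⟨ε⁻¹ * (B₂₂ - A₂₂), by field_simp; ring⟩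
  have hPq₁ : P₁ = p₁ + ε * q₁ := by rw [hq₁]; field_simp; ring
  have hPq₂ : P₂ = p₂ + ε * q₂ := by rw [hq₂]; field_simp; ring
  have E3 : (T₁₁ + T₂₂ + (P₂ ^ 2 * T₁₁ - 2 * P₁ * P₂ * T₁₂ + P₁ ^ 2 * T₂₂))
      + (q₂ * (P₂ + p₂) * A₁₁ - 2 * (q₁ * P₂ + p₁ * q₂) * A₁₂ + q₁ * (P₁ + p₁) * A₂₂
        + (c * l * q₁ + c * k * q₂) * (1 + P₁ ^ 2 + P₂ ^ 2)
        + (c * l * p₁ + c * k * p₂) * (q₁ * (P₁ + p₁) + q₂ * (P₂ + p₂))) = 0 := by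
    have : ε * ((T₁₁ + T₂₂ + (P₂ ^ 2 * T₁₁ - 2 * P₁ * P₂ * T₁₂ + P₁ ^ 2 * T₂₂))
      + (q₂ * (P₂ + p₂) * A₁₁ - 2 * (q₁ * P₂ + p₁ * q₂) * A₁₂ + q₁ * (P₁ + p₁) * A₂₂
        + (c * l * q₁ + c * k * q₂) * (1 + P₁ ^ 2 + P₂ ^ 2)
        + (c * l * p₁ + c * k * p₂) * (q₁ * (P₁ + p₁) + q₂ * (P₂ + p₂)))) = 0 := by
      rw [hT₁₁, hT₁₂, hT₂₂, hPq₁, hPq₂] at E2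
      rw [hPq₁, hPq₂]
      linear_combination E2 - E1
    exact (mul_eq_zero.mp this).resolve_left hε.ne'
  have s1 : ε⁻¹ * (B₁₁ - A₁₁) = T₁₁ := by rw [hT₁₁]; field_simp; ring
  have s2 : ε⁻¹ * (B₂₂ - A₂₂) = T₂₂ := by rw [hT₂₂]; field_simp; ring
  have s3 : ε⁻¹ * (-P₂ * (-P₂ * B₁₁ + P₁ * B₁₂) + P₁ * (-P₂ * B₁₂ + P₁ * B₂₂)
      - (-P₂ * (-P₂ * A₁₁ + P₁ * A₁₂) + P₁ * (-P₂ * A₁₂ + P₁ * A₂₂)))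
      = P₂ ^ 2 * T₁₁ - 2 * P₁ * P₂ * T₁₂ + P₁ ^ 2 * T₂₂ := by
    rw [hT₁₁, hT₁₂, hT₂₂]; field_simp; ring
  rw [s1] at t2
  rw [s2] at t4
  have t6' : (P₂ ^ 2 * T₁₁ - 2 * P₁ * P₂ * T₁₂ + P₁ ^ 2 * T₂₂) * φ ^ 2 ≤
      W * (m * (m + 1) * (-P₂ * Φ₁ + P₁ * Φ₂) ^ 2 - m * φ *
        (a * (P₂ ^ 2 * A₁₁ - 2 * P₁ * P₂ * A₁₂ + P₁ ^ 2 * A₂₂) - z * (P₁ ^ 2 + P₂ ^ 2))) := by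
    rw [← s3]
    refine le_of_le_of_eq (le_of_eq_of_le ?_ t6) ?_ <;> ring
  have E4 := congrArg (fun t => t * φ ^ 2) E3
  simp only [zero_mul] at E4
  linarith

/-- The algebraic inequality forcing a bound on the exponent of the cutoff when the gradient is
large at a limiting maximum point. -/
theorem exponent_bound_of_linearized_inequality {c k l s φ Φ₁ Φ₂ q₁ q₂ A₂₂ a z d₁ d₂ r : ℝ}
    {m : ℕ} (hm : 2 ≤ m) (hkl : k ^ 2 + l ^ 2 = 1) (hr : 0 < r) (ha : 0 < a) (hz : 0 < z)
    (hs : 0 < s) (hs7 : 7 ≤ s ^ 2) (hsa : 4 * z * r ≤ a * s)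
    (hφ0 : 0 < φ) (hφ1 : φ ≤ 1) (hd : d₁ ^ 2 + d₂ ^ 2 ≤ (2 * r) ^ 2)
    (hΦ₁ : Φ₁ = a * s - z * d₁) (hΦ₂ : Φ₂ = - (z * d₂))
    (h1 : q₁ * φ = -(m * s * Φ₁)) (h2 : q₂ * φ = -(m * s * Φ₂))
    (hpde : q₁ + (1 + s ^ 2) * A₂₂ + c * l * s * (1 + s ^ 2) = 0)
    (h : 0 ≤ s * (m * (m + 1) * (Φ₁ ^ 2 + (1 + s ^ 2) * Φ₂ ^ 2)
        - m * φ * (a * (q₁ + (1 + s ^ 2) * A₂₂) - z * (2 + s ^ 2)))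
      + (-2 * s * q₂ ^ 2 + 2 * s * q₁ * A₂₂ + (c * l * q₁ + c * k * q₂) * (1 + s ^ 2)
        + 2 * c * l * s ^ 2 * q₁) * φ ^ 2) :
    m * a ^ 2 ≤ 128 * z * (1 + |c| * r) := by
  have hm' : (2 : ℝ) ≤ m := by exact_mod_cast hm
  set D := 1 + s ^ 2 with hD
  have hD0 : 0 < D := by positivity
  have hlin : c * l * d₁ + c * k * d₂ ≤ |c| * (2 * r) := by
    refine (le_abs_self _).trans (abs_le_of_sq_le_sq ?_ (by positivity))
    have h4 : (l * d₁ + k * d₂) ^ 2 ≤ (2 * r) ^ 2 := by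
      nlinarith [sq_nonneg (k * d₁ - l * d₂)]
    rw [mul_pow, sq_abs]
    calc (c * l * d₁ + c * k * d₂) ^ 2 = c ^ 2 * (l * d₁ + k * d₂) ^ 2 := by ring
      _ ≤ _ := by gcongr
  have hd₁ : |d₁| ≤ 2 * r := abs_le_of_sq_le_sq (by nlinarith [sq_nonneg d₂]) (by positivity)
  have hΦ₁' : a * s / 2 ≤ Φ₁ := by
    have := mul_le_mul_of_nonneg_left ((le_abs_self d₁).trans hd₁) hz.le
    linarith
  have hA : D * A₂₂ = -q₁ - c * l * s * D := by linarith
  have h5 : 0 ≤ s * m * ((m + 1) * D * (Φ₁ ^ 2 + D * Φ₂ ^ 2)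
      - 2 * s ^ 2 * m * (Φ₁ ^ 2 + D * Φ₂ ^ 2) + φ * D * (z * (2 + s ^ 2))
      + φ * D ^ 2 * (z * (c * l * d₁ + c * k * d₂))) := by
    have h6 := mul_nonneg hD0.le h
    have h7 : D * (s * (m * (m + 1) * (Φ₁ ^ 2 + D * Φ₂ ^ 2)
        - m * φ * (a * (q₁ + D * A₂₂) - z * (2 + s ^ 2)))
      + (-2 * s * q₂ ^ 2 + 2 * s * q₁ * A₂₂ + (c * l * q₁ + c * k * q₂) * D
        + 2 * c * l * s ^ 2 * q₁) * φ ^ 2)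
        = D * (s * (m * (m + 1) * (Φ₁ ^ 2 + D * Φ₂ ^ 2)
          + m * φ * (a * (c * l * s * D) + z * (2 + s ^ 2))))
          - 2 * s * D * (q₂ * φ) ^ 2 - 2 * s * (q₁ * φ) ^ 2
          + D ^ 2 * φ * (c * l * (q₁ * φ) + c * k * (q₂ * φ)) := by
      linear_combination (-D * s * m * φ * a + 2 * s * q₁ * φ ^ 2) * hA
    rw [h7, h1, h2] at h6
    refine le_of_le_of_eq h6 ?_
    linear_combination (-s * m * φ * D ^ 2 * c) * (l * hΦ₁ + k * hΦ₂)
  have h8 := nonneg_of_mul_nonneg_right h5 (by positivity)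
  have hcoef : m * s ^ 2 / 4 ≤ 2 * s ^ 2 * m - (m + 1) * D := by
    have := mul_nonneg (by linarith : (0 : ℝ) ≤ 3 * m / 4 - 1) (sub_nonneg.2 hs7)
    rw [hD]; linarith
  have h9 : m * s ^ 2 / 4 * (a * s / 2) ^ 2 ≤
      (2 * s ^ 2 * m - (m + 1) * D) * (Φ₁ ^ 2 + D * Φ₂ ^ 2) := by
    have h10 : (a * s / 2) ^ 2 ≤ Φ₁ ^ 2 := by gcongr
    have h11 : 0 ≤ D * Φ₂ ^ 2 := by positivity
    apply mul_le_mul hcoef (by linarith) (by positivity)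
    exact le_trans (by positivity) hcoef
  have h12 : φ * D * (z * (2 + s ^ 2)) + φ * D ^ 2 * (z * (c * l * d₁ + c * k * d₂))
      ≤ D ^ 2 * (2 * z * (1 + |c| * r)) := by
    have h13 : z * (2 + s ^ 2) ≤ z * (2 * D) := by gcongr; rw [hD]; linarith
    calc φ * D * (z * (2 + s ^ 2)) + φ * D ^ 2 * (z * (c * l * d₁ + c * k * d₂))
        ≤ φ * D * (z * (2 * D)) + φ * D ^ 2 * (z * (|c| * (2 * r))) := by gcongr
      _ = φ * (D ^ 2 * (2 * z * (1 + |c| * r))) := by ring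
      _ ≤ 1 * (D ^ 2 * (2 * z * (1 + |c| * r))) := by gcongr
      _ = _ := one_mul _
  have h14 : D ^ 2 ≤ (2 * s ^ 2) ^ 2 := by gcongr; rw [hD]; linarith
  have h15 : D ^ 2 * (2 * z * (1 + |c| * r)) ≤ (2 * s ^ 2) ^ 2 * (2 * z * (1 + |c| * r)) := by
    gcongr
  have h16 : s ^ 4 * (m * a ^ 2) ≤ s ^ 4 * (128 * z * (1 + |c| * r)) := by
    linarith
  exact le_of_mul_le_mul_left h16 (by positivity)

/-- If localized difference quotients in a direction `(k, l)` have local maxima accumulating at a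
point where the gradient is a large multiple of `(k, l)`, then the cutoff exponent is bounded. -/
theorem IsTranslator.exponent_bound_of_tendsto_max {c : ℝ} {u : ℝ × ℝ → ℝ}
    {Ω : Set (ℝ × ℝ)} (hu : IsTranslator c Ω u) (hΩ : IsOpen Ω) {p y : ℝ × ℝ}
    {a b z k l r s : ℝ} {m : ℕ} (hm : 2 ≤ m) (hkl : k ^ 2 + l ^ 2 = 1) (hr : 0 < r)
    (ha : 0 < a) (hz : 0 < z) {F : Filter ℝ} [F.NeBot] (hF : F ≤ 𝓝[>] 0) {x : ℝ → ℝ × ℝ}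
    (hx : Tendsto x F (𝓝 y)) (hy : y ∈ Ω)
    (hs : fderiv ℝ u y (k, l) = s) (hf : fderiv ℝ u y (-l, k) = 0)
    (hs0 : 0 < s) (hs7 : 7 ≤ s ^ 2) (hsa : 4 * z * r ≤ a * s)
    (hφ0 : 0 < heightCutoff u p a b z y) (hφ1 : heightCutoff u p a b z y ≤ 1)
    (hd : (y.1 - p.1) ^ 2 + (y.2 - p.2) ^ 2 ≤ (2 * r) ^ 2)
    (hmax : ∀ᶠ ε in F, IsLocalMax
      (fun y => ε⁻¹ * (u (y + ε • (k, l)) - u y) * heightCutoff u p a b z y ^ m) (x ε)) :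
    m * a ^ 2 ≤ 128 * z * (1 + |c| * r) := by
  have hε : Tendsto (fun ε : ℝ => ε) F (𝓝 0) := hF.trans nhdsWithin_le_nhds
  have hpos : ∀ᶠ ε in F, (0 : ℝ) < ε := hF self_mem_nhdsWithin
  have hxe : Tendsto (fun ε => x ε + ε • ((k, l) : ℝ × ℝ)) F (𝓝 y) := by
    simpa using hx.add (hε.smul_const ((k, l) : ℝ × ℝ))
  obtain ⟨hstr1, hstr2⟩ := hu.1.hasStrictFDerivAt_fderiv hΩ hy
  have hcu : ContinuousAt u y := hstr1.continuousAt
  have hcφ : ContinuousAt (heightCutoff u p a b z) y := by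
    unfold heightCutoff; fun_prop
  have hcDu : ContinuousAt (fderiv ℝ u) y := hstr2.continuousAt
  have hcD2 : ContinuousAt (fderiv ℝ (fderiv ℝ u)) y := by
    have h1 : ContDiffAt ℝ 1 (fderiv ℝ u) y :=
      (hu.1.contDiffAt (hΩ.mem_nhds hy)).fderiv_right (by norm_num)
    exact (h1.fderiv_right (m := 0) (by norm_num)).continuousAt
  have hDu : ∀ v, ContinuousAt (fun q => fderiv ℝ u q v) y := fun v => by fun_prop
  have hD2 : ∀ v w, ContinuousAt (fun q => fderiv ℝ (fderiv ℝ u) q v w) y := fun v w => by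
    fun_prop
  have tW : Tendsto (fun ε => ε⁻¹ * (u (x ε + ε • (k, l)) - u (x ε))) F (𝓝 s) := by
    have := hstr1.tendsto_difference_quotient (e := (k, l)) hF hx
    rw [hs] at this
    exact this
  have tq : ∀ v, Tendsto (fun ε => ε⁻¹ * (fderiv ℝ u (x ε + ε • (k, l)) v - fderiv ℝ u (x ε) v)) F
      (𝓝 (fderiv ℝ (fderiv ℝ u) y (k, l) v)) := fun v => by
    have h1 := hstr2.tendsto_difference_quotient (e := (k, l)) hF hx
    have h2 := ((ContinuousLinearMap.apply ℝ ℝ v).continuous.tendsto _).comp h1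
    simpa [Function.comp_def] using h2
  have tφ := hcφ.tendsto.comp hx
  have tp₁ : Tendsto (fun ε => fderiv ℝ u (x ε) (k, l)) F (𝓝 s) := by
    have := (hDu (k, l)).tendsto.comp hx
    rwa [hs] at this
  have tp₂ : Tendsto (fun ε => fderiv ℝ u (x ε) (-l, k)) F (𝓝 0) := by
    have := (hDu (-l, k)).tendsto.comp hx
    rwa [hf] at this
  have tP₁ : Tendsto (fun ε => fderiv ℝ u (x ε + ε • (k, l)) (k, l)) F (𝓝 s) := by
    have := (hDu (k, l)).tendsto.comp hxe
    rwa [hs] at this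
  have tP₂ : Tendsto (fun ε => fderiv ℝ u (x ε + ε • (k, l)) (-l, k)) F (𝓝 0) := by
    have := (hDu (-l, k)).tendsto.comp hxe
    rwa [hf] at this
  have tA := fun v w => (hD2 v w).tendsto.comp hx
  have tΦ₁ : Tendsto (fun ε => a * fderiv ℝ u (x ε) (k, l)
      - z * (((x ε).1 - p.1) * k + ((x ε).2 - p.2) * l)) F
      (𝓝 (a * s - z * ((y.1 - p.1) * k + (y.2 - p.2) * l))) := by
    have h1 : Continuous fun q : ℝ × ℝ => z * ((q.1 - p.1) * k + (q.2 - p.2) * l) := by fun_prop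
    exact (tp₁.const_mul a).sub ((h1.tendsto y).comp hx)
  have tΦ₂ : Tendsto (fun ε => a * fderiv ℝ u (x ε) (-l, k)
      - z * (((x ε).1 - p.1) * -l + ((x ε).2 - p.2) * k)) F
      (𝓝 (a * 0 - z * ((y.1 - p.1) * -l + (y.2 - p.2) * k))) := by
    have h1 : Continuous fun q : ℝ × ℝ => z * ((q.1 - p.1) * -l + (q.2 - p.2) * k) := by fun_prop
    exact (tp₂.const_mul a).sub ((h1.tendsto y).comp hx)
  have hWpos := tW.eventually (lt_mem_nhds hs0)
  have hφpos := tφ.eventually (lt_mem_nhds hφ0)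
  have key := ((((hpos.and hmax).and (hx.eventually (hΩ.mem_nhds hy))).and
    (hxe.eventually (hΩ.mem_nhds hy))).and (hWpos.and hφpos)).mono fun ε h =>
      hu.difference_quotient_max_inequality hΩ m h.1.1.1.1 hkl h.1.1.2 h.1.2 rfl rfl rfl rfl rfl rfl
        rfl rfl rfl rfl rfl rfl rfl h.2.1 h.2.2 h.1.1.1.2
  have L1 := tendsto_nhds_unique_of_eventuallyEq ((tq (k, l)).mul tφ)
    ((tW.const_mul (m : ℝ)).mul tΦ₁).neg (key.mono fun ε h => h.1)
  have L2 := tendsto_nhds_unique_of_eventuallyEq ((tq (-l, k)).mul tφ)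
    ((tW.const_mul (m : ℝ)).mul tΦ₂).neg (key.mono fun ε h => h.2.1)
  have tQ := ((((tΦ₁.pow 2).add (tΦ₂.pow 2)).add
    (((tP₂.neg.mul tΦ₁).add (tP₁.mul tΦ₂)).pow 2)).const_mul ((m : ℝ) * (m + 1)))
  have tA' := ((tA (k, l) (k, l)).add (tA (-l, k) (-l, k))).add
    ((((tP₂.pow 2).mul (tA (k, l) (k, l))).sub (((tP₁.const_mul 2).mul tP₂).mul
      (tA (k, l) (-l, k)))).add ((tP₁.pow 2).mul (tA (-l, k) (-l, k))))
  have tH := (tφ.const_mul (m : ℝ)).mul ((tA'.const_mul a).sub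
    ((((tP₁.pow 2).const_add 2).add (tP₂.pow 2)).const_mul z))
  have tR := ((((tq (-l, k)).mul (tP₂.add tp₂)).mul (tA (k, l) (k, l))).sub
    (((((tq (k, l)).mul tP₂).add (tp₁.mul (tq (-l, k)))).const_mul 2).mul
      (tA (k, l) (-l, k)))).add (((tq (k, l)).mul (tP₁.add tp₁)).mul (tA (-l, k) (-l, k)))
  have tb := (((tq (k, l)).const_mul (c * l)).add ((tq (-l, k)).const_mul (c * k))).mul
    (((tP₁.pow 2).const_add 1).add (tP₂.pow 2))
  have tb' := ((tp₁.const_mul (c * l)).add (tp₂.const_mul (c * k))).mul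
    (((tq (k, l)).mul (tP₁.add tp₁)).add ((tq (-l, k)).mul (tP₂.add tp₂)))
  have L3 := ge_of_tendsto ((tW.mul (tQ.sub tH)).add (((tR.add tb).add tb').mul (tφ.pow 2)))
    (key.mono fun ε h => h.2.2)
  have hpde := hu.equation_frame hΩ hy hkl hs.symm hf.symm rfl rfl rfl
  refine exponent_bound_of_linearized_inequality
    (q₂ := fderiv ℝ (fderiv ℝ u) y (k, l) (-l, k)) (l := l) (k := k) (s := s)
    (A₂₂ := fderiv ℝ (fderiv ℝ u) y (-l, k) (-l, k))
    (d₁ := (y.1 - p.1) * k + (y.2 - p.2) * l) (d₂ := (y.1 - p.1) * -l + (y.2 - p.2) * k)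
    hm hkl hr ha hz hs0 hs7 hsa hφ0 hφ1 ?_ rfl rfl L1 ?_ ?_ ?_
  · refine le_of_eq_of_le ?_ hd
    linear_combination ((y.1 - p.1) ^ 2 + (y.2 - p.2) ^ 2) * hkl
  · rw [L2]; ring
  · linear_combination hpde
  · refine le_of_le_of_eq L3 ?_
    ring

/-- The localized gradient bound: at points of the region where the cutoff is nonnegative, the
gradient weighted by a large power of the cutoff is bounded. -/
theorem IsTranslator.gradient_mul_cutoff_le {c : ℝ} {u : ℝ × ℝ → ℝ}
    {Ω : Set (ℝ × ℝ)} (hu : IsTranslator c Ω u) (hΩ : IsOpen Ω) {p : ℝ × ℝ}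
    {a b z r ρ S : ℝ} {m : ℕ} (hm : 2 ≤ m) (hr : 0 < r) (ha : 0 < a) (hz : 0 < z)
    (hma : 128 * z * (1 + |c| * r) < m * a ^ 2) (hρ : ρ ≤ (2 * r) ^ 2)
    (hS7 : 7 ≤ S ^ 2) (hSa : 4 * z * r ≤ a * S) (hS0 : 0 < S)
    (hsub : {y : ℝ × ℝ | (y.1 - p.1) ^ 2 + (y.2 - p.2) ^ 2 ≤ ρ} ⊆ Ω)
    (hle : ∀ y : ℝ × ℝ, (y.1 - p.1) ^ 2 + (y.2 - p.2) ^ 2 ≤ ρ → heightCutoff u p a b z y ≤ 1)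
    (hbdry : ∀ y : ℝ × ℝ, (y.1 - p.1) ^ 2 + (y.2 - p.2) ^ 2 = ρ →
      heightCutoff u p a b z y ≤ 0)
    {q : ℝ × ℝ} (hq : (q.1 - p.1) ^ 2 + (q.2 - p.2) ^ 2 ≤ ρ)
    (hqφ : 0 ≤ heightCutoff u p a b z q) :
    √(pdx u q ^ 2 + pdt u q ^ 2) * heightCutoff u p a b z q ^ m ≤ S := by
  set φ := heightCutoff u p a b z with hφ
  set B : Set (ℝ × ℝ) := {y | (y.1 - p.1) ^ 2 + (y.2 - p.2) ^ 2 ≤ ρ} with hB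
  have hcu : ContinuousOn u Ω := hu.1.continuousOn
  have hcφ : ContinuousOn φ Ω := by
    rw [hφ]; unfold heightCutoff; fun_prop
  have hcDu : ContinuousOn (fderiv ℝ u) Ω := hu.1.continuousOn_fderiv_of_isOpen hΩ (by norm_num)
  have hBclosed : IsClosed B := isClosed_le (by fun_prop) continuous_const
  have hBcompact : IsCompact B := by
    refine (isCompact_closedBall p (2 * r)).of_isClosed_subset hBclosed fun y hy => ?_
    have hy' : (y.1 - p.1) ^ 2 + (y.2 - p.2) ^ 2 ≤ (2 * r) ^ 2 := le_trans hy hρ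
    rw [Metric.mem_closedBall, Prod.dist_eq, max_le_iff, Real.dist_eq, Real.dist_eq]
    exact ⟨abs_le_of_sq_le_sq (by linarith [sq_nonneg (y.2 - p.2)]) (by positivity),
      abs_le_of_sq_le_sq (by linarith [sq_nonneg (y.1 - p.1)]) (by positivity)⟩
  set D : Set (ℝ × ℝ) := B ∩ φ ⁻¹' Ici 0 with hD
  have hDclosed : IsClosed D := (hcφ.mono hsub).preimage_isClosed_of_isClosed hBclosed isClosed_Ici
  have hDcompact : IsCompact D := hBcompact.of_isClosed_subset hDclosed inter_subset_left
  have hDΩ : D ⊆ Ω := inter_subset_left.trans hsub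
  have hDnhds : ∀ y ∈ D, 0 < φ y → D ∈ 𝓝 y := fun y hy hφy => by
    have h1 : (y.1 - p.1) ^ 2 + (y.2 - p.2) ^ 2 < ρ :=
      lt_of_le_of_ne hy.1 fun h => (hbdry y h).not_gt hφy
    have h2 : Continuous fun y : ℝ × ℝ => (y.1 - p.1) ^ 2 + (y.2 - p.2) ^ 2 := by fun_prop
    filter_upwards [h2.continuousAt.eventually (gt_mem_nhds h1),
      (hcφ.continuousAt (hΩ.mem_nhds (hDΩ hy))).eventually (lt_mem_nhds hφy)] with w hw1 hw2
    exact ⟨hw1.le, hw2.le⟩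
  by_contra! hlt
  have hcG : ContinuousOn (fun y => √(pdx u y ^ 2 + pdt u y ^ 2) * φ y ^ m) D := by
    have h1 : ContinuousOn φ D := hcφ.mono hDΩ
    have h2 : ContinuousOn (fderiv ℝ u) D := hcDu.mono hDΩ
    unfold pdx pdt
    fun_prop
  obtain ⟨x₀, hx₀, hx₀max⟩ := hDcompact.exists_isMaxOn ⟨q, hq, hqφ⟩ hcG
  set g := √(pdx u x₀ ^ 2 + pdt u x₀ ^ 2) with hg
  set M := g * φ x₀ ^ m with hM
  have hMS : S < M := hlt.trans_le (hx₀max ⟨hq, hqφ⟩)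
  have hM0 : 0 < M := hS0.trans hMS
  have hφ₀ : 0 ≤ φ x₀ := hx₀.2
  have hg0 : 0 < g := by
    refine lt_of_le_of_ne (Real.sqrt_nonneg _) fun h => ?_
    rw [hM, ← h, zero_mul] at hM0
    exact lt_irrefl _ hM0
  have hgsq : g ^ 2 = pdx u x₀ ^ 2 + pdt u x₀ ^ 2 := Real.sq_sqrt (by positivity)
  obtain ⟨k, hk⟩ : ∃ k, k = pdx u x₀ / g := ⟨_, rfl⟩
  obtain ⟨l, hl⟩ : ∃ l, l = pdt u x₀ / g := ⟨_, rfl⟩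
  have hkl : k ^ 2 + l ^ 2 = 1 := by
    rw [hk, hl, div_pow, div_pow, ← add_div, ← hgsq, div_self (by positivity)]
  have hfrm : ∀ y α β, fderiv ℝ u y (α, β) = α * pdx u y + β * pdt u y := fun y α β => by
    have : ((α, β) : ℝ × ℝ) = α • (1, 0) + β • (0, 1) := by simp
    rw [this, map_add, map_smul, map_smul]
    rfl
  have hx₀e : fderiv ℝ u x₀ (k, l) = g := by
    rw [hfrm, hk, hl]
    field_simp
    linarith
  have hgrad : ∀ y, fderiv ℝ u y (k, l) ^ 2 + fderiv ℝ u y (-l, k) ^ 2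
      = pdx u y ^ 2 + pdt u y ^ 2 := fun y => by
    rw [hfrm, hfrm]
    linear_combination (pdx u y ^ 2 + pdt u y ^ 2) * hkl
  obtain ⟨δ, hδ, hδΩ⟩ := hDcompact.exists_thickening_subset_open hΩ hDΩ
  have hεΩ : ∀ᶠ ε in 𝓝[>] (0 : ℝ), ∀ y ∈ D, y + ε • ((k, l) : ℝ × ℝ) ∈ Ω := by
    have h1 : Tendsto (fun ε : ℝ => ‖ε • ((k, l) : ℝ × ℝ)‖) (𝓝[>] 0) (𝓝 0) := by
      have h2 : Continuous fun ε : ℝ => ‖ε • ((k, l) : ℝ × ℝ)‖ := by fun_prop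
      have h3 := h2.tendsto 0
      rw [zero_smul, norm_zero] at h3
      exact h3.mono_left nhdsWithin_le_nhds
    filter_upwards [h1.eventually (gt_mem_nhds hδ)] with ε h y hy
    exact hδΩ (Metric.mem_thickening_iff.2 ⟨y, hy, by rwa [dist_eq_norm, add_sub_cancel_left]⟩)
  have hex : ∀ ε : ℝ, ∃ x ∈ D, (∀ y ∈ D, y + ε • ((k, l) : ℝ × ℝ) ∈ Ω) →
      IsMaxOn (fun y => ε⁻¹ * (u (y + ε • (k, l)) - u y) * φ y ^ m) D x := fun ε => by
    by_cases h : ∀ y ∈ D, y + ε • ((k, l) : ℝ × ℝ) ∈ Ω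
    · have h1 : ContinuousOn φ D := hcφ.mono hDΩ
      have h2 : ContinuousOn u D := hcu.mono hDΩ
      have h3 : ContinuousOn (fun y => u (y + ε • (k, l))) D := hcu.comp (by fun_prop) h
      obtain ⟨x, hx, hxm⟩ := hDcompact.exists_isMaxOn ⟨q, hq, hqφ⟩
        (((h3.sub h2).const_mul ε⁻¹).mul (h1.pow m))
      exact ⟨x, hx, fun _ => hxm⟩
    · exact ⟨x₀, hx₀, fun h' => (h h').elim⟩
  choose x hxD hxmax using hex
  let F : Ultrafilter ℝ := Ultrafilter.of (𝓝[>] 0)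
  have hF : (F : Filter ℝ) ≤ 𝓝[>] 0 := Ultrafilter.of_le _
  obtain ⟨y, hyD, hxy⟩ := hDcompact.ultrafilter_le_nhds' (F.map x)
    (Ultrafilter.mem_map.2 (Filter.univ_mem' hxD))
  have hx : Tendsto x F (𝓝 y) := hxy
  have hyΩ := hDΩ hyD
  have tW := (hu.1.hasStrictFDerivAt_fderiv hΩ hyΩ).1.tendsto_difference_quotient
    (e := (k, l)) hF hx
  have tW₀ := (hu.1.hasStrictFDerivAt_fderiv hΩ (hDΩ hx₀)).1.tendsto_difference_quotient
    (e := (k, l)) hF (tendsto_const_nhds (x := x₀))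
  have tφ := (hcφ.continuousAt (hΩ.mem_nhds hyΩ)).tendsto.comp hx
  obtain ⟨s, hs⟩ : ∃ s, fderiv ℝ u y (k, l) = s := ⟨_, rfl⟩
  have hMs : M ≤ s * φ y ^ m := by
    rw [hM, ← hx₀e, ← hs]
    refine le_of_tendsto_of_tendsto (tW₀.mul_const (φ x₀ ^ m)) (tW.mul (tφ.pow m)) ?_
    filter_upwards [hF hεΩ] with ε h
    exact hxmax ε h hx₀
  have hφy0 : 0 ≤ φ y := hyD.2
  have hφy : 0 < φ y := by
    refine lt_of_le_of_ne hφy0 fun h => ?_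
    rw [← h, zero_pow (by omega), mul_zero] at hMs
    exact hMs.not_gt hM0
  have hs0 : 0 < s := pos_of_mul_pos_left (hM0.trans_le hMs) (by positivity)
  have hsM : M ≤ s := hMs.trans (mul_le_of_le_one_right hs0.le (pow_le_one₀ hφy0 (hle y hyD.1)))
  have hf : fderiv ℝ u y (-l, k) = 0 := by
    have h1 : √(pdx u y ^ 2 + pdt u y ^ 2) * φ y ^ m ≤ s * φ y ^ m := (hx₀max hyD).trans hMs
    have h2 : √(pdx u y ^ 2 + pdt u y ^ 2) ≤ s := le_of_mul_le_mul_right h1 (by positivity)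
    rw [Real.sqrt_le_left hs0.le, ← hgrad, hs] at h2
    exact pow_eq_zero_iff two_ne_zero |>.1 (le_antisymm (by linarith) (sq_nonneg _))
  refine hma.not_ge (hu.exponent_bound_of_tendsto_max hΩ (p := p) (b := b) hm hkl hr ha hz hF hx
    hyΩ hs hf hs0 ?_ ?_ hφy (hle y hyD.1) (hyD.1.trans hρ) ?_)
  · nlinarith
  · nlinarith
  · filter_upwards [hF hεΩ, hx.eventually (eventually_mem_nhds_iff.2 (hDnhds y hyD hφy))]
      with ε h1 h2
    exact (hxmax ε h1).isLocalMax h2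

/-- Interior gradient estimate: a sequence of c-translator solutions that is uniformly
bounded on a Euclidean ball `B_{2r}(p) ⊂⊂ Ω` has uniformly bounded gradient on the
concentric ball `B_r(p)`. -/
theorem interior_gradient_estimate (c : ℝ) (Ω : Set (ℝ × ℝ)) (hΩ : IsOpen Ω)
    (u : ℕ → ℝ × ℝ → ℝ) (hu : ∀ n, IsTranslator c Ω (u n))
    (p : ℝ × ℝ) (hp : p ∈ Ω) (r : ℝ) (hr : 0 < r)
    (hball : {q : ℝ × ℝ | eDist q p ≤ 2 * r} ⊆ Ω)
    (K : ℝ) (hK : 0 < K)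
    (hbnd : ∀ n : ℕ, ∀ q : ℝ × ℝ, eDist q p < 2 * r → |u n q| ≤ K) :
    ∃ C > 0, ∀ n : ℕ, ∀ q : ℝ × ℝ, eDist q p < r →
      Real.sqrt (pdx (u n) q ^ 2 + pdt (u n) q ^ 2) ≤ C := by
  have hsq : ∀ q : ℝ × ℝ, ∀ R : ℝ, 0 < R →
      (eDist q p < R ↔ (q.1 - p.1) ^ 2 + (q.2 - p.2) ^ 2 < R ^ 2) := fun q R hR =>
    Real.sqrt_lt' hR
  obtain ⟨a, ha⟩ : ∃ a, a = 1 / (4 * K) := ⟨_, rfl⟩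
  obtain ⟨z, hz⟩ : ∃ z, z = 2 / (3 * r ^ 2) := ⟨_, rfl⟩
  have ha0 : 0 < a := by rw [ha]; positivity
  have hz0 : 0 < z := by rw [hz]; positivity
  have haK : a * K = 1 / 4 := by rw [ha]; field_simp
  have hzr : z * r ^ 2 = 2 / 3 := by rw [hz]; field_simp
  obtain ⟨N, hN⟩ := exists_nat_gt (128 * z * (1 + |c| * r) / a ^ 2)
  rw [div_lt_iff₀ (by positivity)] at hN
  have hm : 128 * z * (1 + |c| * r) < (N + 2 : ℕ) * a ^ 2 := by
    push_cast
    nlinarith [sq_nonneg a]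
  obtain ⟨S, hS⟩ : ∃ S, S = 3 + 4 * z * r / a := ⟨_, rfl⟩
  have hS3 : 3 ≤ S := by
    rw [hS]
    have : 0 ≤ 4 * z * r / a := by positivity
    linarith
  have hSa : 4 * z * r ≤ a * S := by
    rw [hS, mul_add, mul_div_cancel₀ _ ha0.ne']
    linarith
  refine ⟨S * 6 ^ (N + 2), by positivity, fun n q hq => ?_⟩
  have hb : ∀ y : ℝ × ℝ, (y.1 - p.1) ^ 2 + (y.2 - p.2) ^ 2 ≤ 3 * r ^ 2 →
      |a * u n y| ≤ 1 / 4 := fun y hy => by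
    rw [abs_mul, abs_of_pos ha0, ← haK]
    gcongr
    exact hbnd n y ((hsq y (2 * r) (by positivity)).2 (by nlinarith))
  have hq' : (q.1 - p.1) ^ 2 + (q.2 - p.2) ^ 2 < r ^ 2 := (hsq q r hr).1 hq
  have hq3 : (q.1 - p.1) ^ 2 + (q.2 - p.2) ^ 2 ≤ 3 * r ^ 2 := by nlinarith
  have hφq : 1 / 6 ≤ heightCutoff (u n) p a (3 / 4) z q := by
    have h1 := (abs_le.1 (hb q hq3)).1
    have h2 := mul_le_mul_of_nonneg_left hq'.le hz0.le
    unfold heightCutoff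
    linarith
  have key := (hu n).gradient_mul_cutoff_le hΩ (p := p) (b := 3 / 4) (ρ := 3 * r ^ 2) (S := S)
    (by omega) hr ha0 hz0 hm (by nlinarith) (by nlinarith) hSa (by linarith)
    (fun y hy => hball (Real.sqrt_le_iff.2 ⟨by positivity, by
      have hy' : (y.1 - p.1) ^ 2 + (y.2 - p.2) ^ 2 ≤ 3 * r ^ 2 := hy
      nlinarith⟩))
    (fun y hy => by
      have h1 := (abs_le.1 (hb y hy)).2
      have h2 : 0 ≤ z / 2 * ((y.1 - p.1) ^ 2 + (y.2 - p.2) ^ 2) := by positivity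
      unfold heightCutoff
      linarith)
    (fun y hy => by
      have h1 := (abs_le.1 (hb y hy.le)).2
      unfold heightCutoff
      rw [hy]
      linarith)
    hq3 (by linarith)
  have hpow : (1 / 6 : ℝ) ^ (N + 2) ≤ heightCutoff (u n) p a (3 / 4) z q ^ (N + 2) := by gcongr
  have h1 := (mul_le_mul_of_nonneg_left hpow (Real.sqrt_nonneg _)).trans key
  rw [one_div, inv_pow, ← div_eq_mul_inv, div_le_iff₀ (by positivity)] at h1
  exact h1
end
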